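/- Under the Cayley setup, for all 0 ≤ k ≤ d the h-vector of F satisfies the recurrence inequality h_{k+1}(F) ≤ (n1+n2−d−1+k)/(k+1) · h_k(F) + n1/(k+1) · g_k(∂P2) + n2/(k+1) · g_k(∂P1). -/

import Mathlib

open Set Pointwise

noncomputable section

/-- Euclidean `d`-space `E^d`, modeled as `Fin d → ℝ`. -/
abbrev Euc (d : ℕ) : Type := Fin d → ℝ

/-- The (affine) dimension of a subset of Euclidean space: the dimension of its affine hull. -/
def setDim {d : ℕ} (F : Set (Euc d)) : ℕ :=
  Module.finrank ℝ (affineSpan ℝ F).direction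

/-- A (convex) polytope: the convex hull of a finite point set. -/
def IsPolytope {d : ℕ} (P : Set (Euc d)) : Prop :=
  ∃ S : Set (Euc d), S.Finite ∧ P = convexHull ℝ S

/-- `F` is a proper (nonempty) face of `P`: `F` is an exposed face of `P` (the intersection
of `P` with a supporting hyperplane) which is nonempty and different from `P` itself. -/
def IsProperFaceOf {d : ℕ} (P F : Set (Euc d)) : Prop :=
  IsExposed ℝ P F ∧ F ≠ P ∧ F.Nonempty

/-- The vertex set of a polytope: its set of extreme points. -/
def vertSet {d : ℕ} (P : Set (Euc d)) : Set (Euc d) :=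
  Set.extremePoints ℝ P

/-- The number of vertices of a polytope. -/
def vertCount {d : ℕ} (P : Set (Euc d)) : ℕ := (vertSet P).ncard

/-- `faceCount P k` is `f_k(P)`, the number of `k`-dimensional (proper) faces of `P`. -/
def faceCount {d : ℕ} (P : Set (Euc d)) (k : ℕ) : ℕ :=
  {F : Set (Euc d) | IsProperFaceOf P F ∧ setDim F = k}.ncard

/-- The moment curve `t ↦ (t, t², …, t^δ)` in `E^δ`. -/
def momentCurve (δ : ℕ) (t : ℝ) : Euc δ := fun i => t ^ ((i : ℕ) + 1)

/-- A standard realization of the cyclic `δ`-polytope `C_δ(n)` with `n` vertices: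
the convex hull of `n` distinct points on the moment curve. -/
def cyclicPolytope (δ n : ℕ) : Set (Euc δ) :=
  convexHull ℝ (momentCurve δ '' (Set.range fun j : Fin n => (j : ℝ) + 1))

/-- `S` is the vertex set of a proper face of `P` of dimension `|S| - 1`. -/
def IsSimplexFaceVertexSet {d : ℕ} (P S : Set (Euc d)) : Prop :=
  ∃ F : Set (Euc d), IsProperFaceOf P F ∧ vertSet F = S ∧ setDim F + 1 = S.ncard

/-- A polytope `P` is `(V1; k)`-bineighborly: `V1` is a nonempty proper subset of the vertex
set of `P`, and for all nonempty `S1 ⊆ V1` and `S2 ⊆ V ∖ V1` with `|S1| + |S2| ≤ k`,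
the set `S1 ∪ S2` is the vertex set of a face of `P` of dimension `|S1| + |S2| - 1`. -/
def PolytopeBineighborly {d : ℕ} (P V1 : Set (Euc d)) (k : ℕ) : Prop :=
  V1.Nonempty ∧ V1 ⊂ vertSet P ∧
    ∀ S1 S2 : Set (Euc d), S1.Nonempty → S2.Nonempty →
      S1 ⊆ V1 → S2 ⊆ vertSet P \ V1 → S1.ncard + S2.ncard ≤ k →
        IsSimplexFaceVertexSet P (S1 ∪ S2)

/-- A polytope is `k`-neighborly if every nonempty subset of at most `k` of its vertices is
the vertex set of a face. -/
def PolytopeNeighborly {d : ℕ} (P : Set (Euc d)) (k : ℕ) : Prop :=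
  ∀ S : Set (Euc d), S ⊆ vertSet P → S.Nonempty → S.ncard ≤ k →
    ∃ F : Set (Euc d), IsProperFaceOf P F ∧ vertSet F = S

/-- Embed `E^d` into the hyperplane `{x_{d+1} = c}` of `E^{d+1}`. -/
def lift {d : ℕ} (c : ℝ) (x : Euc d) : Euc (d + 1) := Fin.snoc x c

/-- The Cayley polytope `CH_{d+1}({P1, P2})` of `P1` embedded in `{x_{d+1} = 0}` and
`P2` embedded in `{x_{d+1} = 1}`. -/
def cayley {d : ℕ} (P1 P2 : Set (Euc d)) : Set (Euc (d + 1)) :=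
  convexHull ℝ (lift 0 '' P1 ∪ lift 1 '' P2)

/-- `ubTerm n d k = binom (n - d - 2 + k) k` (equal to the true binomial for `n ≥ d + 1`). -/
def ubTerm (n d k : ℕ) : ℕ := (n + k - (d + 2)).choose k

/-- The upper bound for `f_{k-1}(P1 ⊕ P2)`:
`f_k(C_{d+1}(n1+n2)) - ∑_{i=0}^{⌊(d+1)/2⌋} binom(d+1-i, k+1-i) (binom(n1-d-2+i, i) + binom(n2-d-2+i, i))`. -/
def minkBound (d n1 n2 k : ℕ) : ℤ :=
  (faceCount (cyclicPolytope (d + 1) (n1 + n2)) k : ℤ)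
    - ∑ i ∈ Finset.range ((d + 1) / 2 + 1),
        (if i ≤ k + 1 then ((d + 1 - i).choose (k + 1 - i) : ℤ) else 0)
          * ((ubTerm n1 d i : ℤ) + (ubTerm n2 d i : ℤ))

/-- A polytopal complex in `E^N`: a finite nonempty collection of polytopes containing `∅`,
closed under taking faces, such that pairwise intersections are faces of both. -/
structure PolyComplex (N : ℕ) where
  faces : Set (Set (Euc N))
  finite_faces : faces.Finite
  empty_mem : ∅ ∈ faces
  polytope_mem : ∀ F ∈ faces, IsPolytope F
  down_closed : ∀ F ∈ faces, ∀ G : Set (Euc N), IsExposed ℝ F G → G ∈ faces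
  inter_face : ∀ F ∈ faces, ∀ G ∈ faces, IsExposed ℝ F (F ∩ G) ∧ IsExposed ℝ G (F ∩ G)

namespace PolyComplex

/-- The vertex set of a complex: its `0`-dimensional faces. -/
def verts {N : ℕ} (C : PolyComplex N) : Set (Euc N) := {v : Euc N | {v} ∈ C.faces}

/-- `C` is a (pure-dimension-bounded) `d`-complex: all faces have dimension at most `d`
and some face has dimension exactly `d`. -/
def IsDComplex {N : ℕ} (C : PolyComplex N) (d : ℕ) : Prop :=
  (∀ F ∈ C.faces, setDim F ≤ d) ∧ ∃ F ∈ C.faces, setDim F = d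

/-- A complex `C` is `(V1; k)`-bineighborly. -/
def Bineighborly {N : ℕ} (C : PolyComplex N) (V1 : Set (Euc N)) (k : ℕ) : Prop :=
  V1.Nonempty ∧ V1 ⊂ C.verts ∧
    ∀ S1 S2 : Set (Euc N), S1.Nonempty → S2.Nonempty →
      S1 ⊆ V1 → S2 ⊆ C.verts \ V1 → S1.ncard + S2.ncard ≤ k →
        ∃ F ∈ C.faces, vertSet F = S1 ∪ S2 ∧ setDim F + 1 = S1.ncard + S2.ncard

/-- A complex is `k`-neighborly if every nonempty subset of at most `k` of its vertices is
the vertex set of a face. -/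
def Neighborly {N : ℕ} (C : PolyComplex N) (k : ℕ) : Prop :=
  ∀ S : Set (Euc N), S ⊆ C.verts → S.Nonempty → S.ncard ≤ k →
    ∃ F ∈ C.faces, vertSet F = S

end PolyComplex

/-- `F` is a simplex: the convex hull of an affinely independent finite point set. -/
def IsSimplexSet {d : ℕ} (F : Set (Euc d)) : Prop :=
  ∃ S : Finset (Euc d),
    AffineIndependent ℝ (fun v : {x // x ∈ S} => (v : Euc d)) ∧
      F = convexHull ℝ (S : Set (Euc d))

/-- A simplicial polytope: all its proper faces are simplices. -/
def IsSimplicialPolytope {d : ℕ} (P : Set (Euc d)) : Prop :=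
  IsPolytope P ∧ ∀ F : Set (Euc d), IsProperFaceOf P F → IsSimplexSet F

/-- The collection `𝓕` of proper faces of the Cayley polytope of `P1`, `P2` having at least one
vertex in (the embedded copy of) each of `P1` and `P2`. -/
def cayleyFaces {d : ℕ} (P1 P2 : Set (Euc d)) : Set (Set (Euc (d + 1))) :=
  {F : Set (Euc (d + 1)) | IsProperFaceOf (cayley P1 P2) F ∧
    (vertSet F ∩ lift 0 '' P1).Nonempty ∧ (vertSet F ∩ lift 1 '' P2).Nonempty}

/-- `fFm1 P1 P2 k = f_{k-1}(𝓕)`, with the convention `f_{-1}(𝓕) = -1`. -/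
def fFm1 {d : ℕ} (P1 P2 : Set (Euc d)) : ℕ → ℤ
  | 0 => -1
  | (k + 1) => (({F ∈ cayleyFaces P1 P2 | setDim F = k} : Set (Set (Euc (d + 1)))).ncard : ℤ)

/-- The `h`-vector of `𝓕`: `h_k(𝓕) = ∑_{i=0}^{k} (-1)^{k-i} binom(d+1-i, d+1-k) f_{i-1}(𝓕)`. -/
def hF {d : ℕ} (P1 P2 : Set (Euc d)) (k : ℕ) : ℤ :=
  ∑ i ∈ Finset.range (k + 1),
    (-1 : ℤ) ^ (k - i) * ((d + 1 - i).choose (d + 1 - k) : ℤ) * fFm1 P1 P2 i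

/-- `fBdm1 P k = f_{k-1}(∂P)`, with `f_{-1}(∂P) = 1`. -/
def fBdm1 {d : ℕ} (P : Set (Euc d)) : ℕ → ℤ
  | 0 => 1
  | (k + 1) => (faceCount P k : ℤ)

/-- The `h`-vector of the boundary complex of a `d`-polytope `P ⊆ E^d`:
`h_k(∂P) = ∑_{i=0}^{k} (-1)^{k-i} binom(d-i, d-k) f_{i-1}(∂P)`. -/
def hBd {d : ℕ} (P : Set (Euc d)) (k : ℕ) : ℤ :=
  ∑ i ∈ Finset.range (k + 1),
    (-1 : ℤ) ^ (k - i) * ((d - i).choose (d - k) : ℤ) * fBdm1 P i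

/-- The `g`-vector of `∂P`: `g_0 = h_0 (= 1)` and `g_k = h_k - h_{k-1}`, with the
convention `h_{d+1}(∂P) = 0`. -/
def gBd {d : ℕ} (P : Set (Euc d)) (k : ℕ) : ℤ :=
  (if k ≤ d then hBd P k else 0)
    - (if k = 0 then 0 else if k - 1 ≤ d then hBd P (k - 1) else 0)

/-- `fCycm1 δ n k = f_{k-1}(C_δ(n))`, with `f_{-1} = 1`. -/
def fCycm1 (δ n k : ℕ) : ℤ :=
  if k = 0 then 1 else (faceCount (cyclicPolytope δ n) (k - 1) : ℤ)

/-- The upper bound for `f_{k-1}(𝓕)`: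
`f_{k-1}(C_{d+1}(n1+n2)) - ∑_{i=0}^{⌊(d+1)/2⌋} binom(d+1-i, k-i)(binom(n1-d-2+i,i)+binom(n2-d-2+i,i))`. -/
def cayleyBound (d n1 n2 k : ℕ) : ℤ :=
  fCycm1 (d + 1) (n1 + n2) k
    - ∑ i ∈ Finset.range ((d + 1) / 2 + 1),
        (if i ≤ k then ((d + 1 - i).choose (k - i) : ℤ) else 0)
          * ((ubTerm n1 d i : ℤ) + (ubTerm n2 d i : ℤ))

/-- The moment-like curve `γ1(t; ζ) = (t, ζ t^d, t², t³, …, t^{d-1}, 0)` in `E^{d+1}`. -/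
def gamma1 (d : ℕ) (ζ t : ℝ) : Euc (d + 1) := fun i =>
  if (i : ℕ) = 0 then t
  else if (i : ℕ) = 1 then ζ * t ^ d
  else if (i : ℕ) = d then 0
  else t ^ (i : ℕ)

/-- The moment-like curve `γ2(s; ζ) = (ζ s^d, s, s², s³, …, s^{d-1}, 1)` in `E^{d+1}`. -/
def gamma2 (d : ℕ) (ζ s : ℝ) : Euc (d + 1) := fun i =>
  if (i : ℕ) = 0 then ζ * s ^ d
  else if (i : ℕ) = 1 then s
  else if (i : ℕ) = d then 1
  else s ^ (i : ℕ)

/-- The `(k+ℓ) × (k+ℓ)` matrix whose determinant is `D_{k,ℓ}(τ)`: rows are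
`(1,…,1,0,…,0)`, `(x₁τ,…,x_kτ,0,…,0)`, `(0,…,0,1,…,1)`, `(0,…,0,y₁,…,y_ℓ)` and
`(x₁^pτ^p,…,x_k^pτ^p,y₁^p,…,y_ℓ^p)` for `p = 2, …, k+ℓ-3`. -/
def Dmat (k l : ℕ) (x : Fin k → ℝ) (y : Fin l → ℝ) (τ : ℝ) :
    Matrix (Fin (k + l)) (Fin (k + l)) ℝ :=
  Matrix.of fun r c =>
    have hcl : (c : ℕ) < k + l := c.isLt
    if hc : (c : ℕ) < k then
      if (r : ℕ) = 0 then 1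
      else if (r : ℕ) = 1 then x ⟨(c : ℕ), hc⟩ * τ
      else if (r : ℕ) = 2 then 0
      else if (r : ℕ) = 3 then 0
      else (x ⟨(c : ℕ), hc⟩ * τ) ^ ((r : ℕ) - 2)
    else
      have hck : (c : ℕ) - k < l := by omega
      if (r : ℕ) = 0 then 0
      else if (r : ℕ) = 1 then 0
      else if (r : ℕ) = 2 then 1
      else if (r : ℕ) = 3 then y ⟨(c : ℕ) - k, hck⟩
      else y ⟨(c : ℕ) - k, hck⟩ ^ ((r : ℕ) - 2)

/-- The exponent vector `μ = (0, 1, k, k+1, …, k+ℓ-3)`. -/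
def muExp (k i : ℕ) : ℕ := if i = 0 then 0 else if i = 1 then 1 else k + i - 2

/-- The Vandermonde determinant `VD(x) = ∏_{i<j} (x_j - x_i)`. -/
def VDprod {k : ℕ} (x : Fin k → ℝ) : ℝ :=
  ∏ p ∈ Finset.univ.filter (fun p : Fin k × Fin k => p.1 < p.2), (x p.2 - x p.1)

/-- The generalized Vandermonde determinant `GVD(y; μ) = det (y_j^{μ_i})` with exponent
vector `μ = (0, 1, k, k+1, …, k+ℓ-3)`. -/
def GVDdet (k : ℕ) {l : ℕ} (y : Fin l → ℝ) : ℝ :=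
  (Matrix.of fun i j : Fin l => y j ^ muExp k (i : ℕ)).det

/-- `binom(a, b)` for an integer lower index, zero when `b < 0` or `b > a`. -/
def zchoose (a : ℕ) (b : ℤ) : ℝ := if 0 ≤ b then (a.choose b.toNat : ℝ) else 0

/-- The alternating binomial transform `∑_{i=0}^{k} (-1)^{k-i} binom(D-i, D-k) f_i` which turns
the face numbers `f_i` (of faces with `i` vertices) into the `k`-th entry of an `h`-vector. -/
def hTransform (D k : ℕ) (f : ℕ → ℤ) : ℤ :=
  ∑ i ∈ Finset.range (k + 1), (-1 : ℤ) ^ (k - i) * ((D - i).choose (D - k) : ℤ) * f i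

lemma hTransform_congr {D k : ℕ} {f g : ℕ → ℤ} (h : ∀ i ≤ k, f i = g i) :
    hTransform D k f = hTransform D k g := by
  refine Finset.sum_congr rfl fun i hi => ?_
  rw [h i (by simpa [Nat.lt_succ_iff] using hi)]

lemma hTransform_add (D k : ℕ) (f g : ℕ → ℤ) :
    hTransform D k (fun i => f i + g i) = hTransform D k f + hTransform D k g := by
  simp only [hTransform, mul_add, Finset.sum_add_distrib]

lemma hTransform_sum {α : Type*} (s : Finset α) (D k : ℕ) (f : α → ℕ → ℤ) :
    hTransform D k (fun i => ∑ a ∈ s, f a i) = ∑ a ∈ s, hTransform D k (f a) := by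
  simp only [hTransform, Finset.mul_sum]
  exact Finset.sum_comm

/-- The number of `i`-element sets between an `r`-element set and a `D`-element superset. -/
def intervalCount (D r i : ℕ) : ℤ := if r ≤ i then ((D - r).choose (i - r) : ℤ) else 0

lemma hTransform_intervalCount {D k : ℕ} (hk : k ≤ D) (r : ℕ) :
    hTransform D k (intervalCount D r) = if r = k then 1 else 0 := by
  rcases lt_or_ge k r with hr | hr
  · rw [if_neg (by omega)]
    refine Finset.sum_eq_zero fun i hi => ?_
    rw [Finset.mem_range] at hi
    rw [intervalCount, if_neg (by omega), mul_zero]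
  obtain ⟨m, rfl⟩ := Nat.exists_eq_add_of_le hr
  have hsplit : hTransform D (r + m) (intervalCount D r) =
      ∑ j ∈ Finset.range (m + 1),
        (-1 : ℤ) ^ (m - j) * ((D - (r + j)).choose (D - (r + m)) : ℤ) * ((D - r).choose j) := by
    rw [hTransform, add_assoc, Finset.sum_range_add, Finset.sum_eq_zero, zero_add]
    · refine Finset.sum_congr rfl fun j _ => ?_
      rw [intervalCount, if_pos (by omega), Nat.add_sub_cancel_left, Nat.add_sub_add_left]
    · intro i hi
      rw [Finset.mem_range] at hi
      rw [intervalCount, if_neg (by omega), mul_zero]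
  have hterm : ∀ j ∈ Finset.range (m + 1),
      (-1 : ℤ) ^ (m - j) * ((D - (r + j)).choose (D - (r + m)) : ℤ) * ((D - r).choose j) =
        ((-1) ^ m * ((D - r).choose m : ℤ)) * ((-1) ^ j * (m.choose j : ℤ)) := by
    intro j hj
    rw [Finset.mem_range] at hj
    have hj' : j ≤ m := by omega
    have h1 : (D - (r + j)).choose (D - (r + m)) = (D - r - j).choose (m - j) := by
      rw [← Nat.choose_symm (by omega)]
      congr 1 <;> omega
    have h2 : (((D - r).choose m : ℤ)) * (m.choose j) =
        (D - r).choose j * (D - r - j).choose (m - j) := by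
      exact_mod_cast Nat.choose_mul hj'
    have h3 : (-1 : ℤ) ^ (m - j) = (-1) ^ m * (-1) ^ j := by
      have : (-1 : ℤ) ^ m = (-1) ^ (m - j) * (-1) ^ j := by rw [← pow_add]; congr 1; omega
      rw [this, mul_assoc, ← mul_pow]; simp
    rw [h1, h3]
    linear_combination (-((-1) ^ m * (-1) ^ j)) * h2
  rw [hsplit, Finset.sum_congr rfl hterm, ← Finset.mul_sum, Int.alternating_sum_range_choose]
  by_cases hm : m = 0
  · simp [hm]
  · rw [if_neg hm, if_neg (by omega), mul_zero]

lemma hTransform_pascal {d k : ℕ} (hk : k ≤ d) (f : ℕ → ℤ) :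
    hTransform (d + 1) k f =
      hTransform d k f - if k = 0 then 0 else hTransform d (k - 1) f := by
  rcases k with _ | k
  · simp [hTransform]
  rw [if_neg (by omega), Nat.add_sub_cancel]
  simp only [hTransform]
  rw [Finset.sum_range_succ _ (k + 1), Finset.sum_range_succ _ (k + 1), add_sub_right_comm,
    ← Finset.sum_sub_distrib]
  congr 1
  · refine Finset.sum_congr rfl fun i hi => ?_
    rw [Finset.mem_range] at hi
    have h1 : (d + 1 - i).choose (d + 1 - (k + 1)) =
        (d - i).choose (d - (k + 1)) + (d - i).choose (d - k) := by
      have e1 : d + 1 - i = (d - i) + 1 := by omega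
      have e2 : d + 1 - (k + 1) = (d - (k + 1)) + 1 := by omega
      have e3 : d - k = (d - (k + 1)) + 1 := by omega
      rw [e1, e2, e3, Nat.choose_succ_succ]
    have h2 : (-1 : ℤ) ^ (k + 1 - i) = -(-1) ^ (k - i) := by
      rw [show k + 1 - i = (k - i) + 1 by omega, pow_succ]; ring
    rw [h1, h2]
    push_cast
    ring
  · simp

lemma hTransform_derivative {d k : ℕ} (hk : k ≤ d) (f : ℕ → ℤ) :
    hTransform d k (fun i => ((i : ℤ) + 1) * f (i + 1)) =
      ((d : ℤ) + 1 - k) * hTransform (d + 1) k f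
        + ((k : ℤ) + 1) * hTransform (d + 1) (k + 1) f := by
  have hext : hTransform (d + 1) k f = ∑ i ∈ Finset.range (k + 1 + 1),
      (-1 : ℤ) ^ (k - i) * ((d + 1 - i).choose (d + 1 - k) : ℤ) * f i := by
    rw [Finset.sum_range_succ, Nat.choose_eq_zero_of_lt (by omega)]
    simp [hTransform]
  have hterm : ∀ j ≤ k + 1,
      ((d : ℤ) + 1 - k) * ((-1 : ℤ) ^ (k - j) * ((d + 1 - j).choose (d + 1 - k) : ℤ) * f j) +
        ((k : ℤ) + 1) *
          ((-1 : ℤ) ^ (k + 1 - j) * ((d + 1 - j).choose (d + 1 - (k + 1)) : ℤ) * f j) =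
      (-1 : ℤ) ^ (k + 1 - j) * ((d + 1 - j).choose (d - k) : ℤ) * (j * f j) := by
    intro j hj
    have h1 : ((d + 1 - j).choose (d + 1 - k) : ℤ) * ((d : ℤ) + 1 - k) =
        (d + 1 - j).choose (d - k) * ((k : ℤ) + 1 - j) := by
      have := Nat.choose_succ_right_eq (d + 1 - j) (d - k)
      rw [show d - k + 1 = d + 1 - k by omega,
        show d + 1 - j - (d - k) = k + 1 - j by omega] at this
      zify [hj, show k ≤ d + 1 by omega] at this
      exact this
    rw [show d + 1 - (k + 1) = d - k by omega]
    rcases Nat.lt_or_ge k j with h | h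
    · obtain rfl : j = k + 1 := by omega
      rw [Nat.choose_eq_zero_of_lt (show d + 1 - (k + 1) < d + 1 - k by omega)]
      push_cast
      ring
    · rw [show k + 1 - j = (k - j) + 1 by omega, pow_succ]
      linear_combination ((-1) ^ (k - j) * f j) * h1
  rw [hext, hTransform, Finset.mul_sum, hTransform, Finset.mul_sum, ← Finset.sum_add_distrib,
    Finset.sum_congr rfl fun j hj => hterm j (by simpa [Nat.lt_succ_iff] using hj),
    Finset.sum_range_succ' _ (k + 1)]
  simp only [Nat.cast_zero, zero_mul, mul_zero, add_zero]
  refine Finset.sum_congr rfl fun i _ => ?_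
  rw [Nat.add_sub_add_right, Nat.add_sub_add_right]
  push_cast
  ring

section Partition

variable {X : Type*} [DecidableEq X]

lemma card_interval_eq_intervalCount {ρ σ : Finset X} (h : ρ ⊆ σ) (i : ℕ) :
    (({τ ∈ σ.powerset | ρ ⊆ τ ∧ τ.card = i} : Finset (Finset X)).card : ℤ) =
      intervalCount σ.card ρ.card i := by
  rw [intervalCount]
  split_ifs with hi
  · rw [← Finset.card_sdiff_of_subset h, ← Finset.card_powersetCard]
    congr 1
    refine Finset.card_bij' (fun τ _ => τ \ ρ) (fun τ _ => τ ∪ ρ) ?_ ?_ ?_ ?_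
    · intro τ hτ
      simp only [Finset.mem_filter, Finset.mem_powerset, Finset.mem_powersetCard] at hτ ⊢
      exact ⟨Finset.sdiff_subset_sdiff hτ.1 subset_rfl, by
        rw [Finset.card_sdiff_of_subset hτ.2.1, hτ.2.2]⟩
    · intro τ hτ
      simp only [Finset.mem_filter, Finset.mem_powerset, Finset.mem_powersetCard] at hτ ⊢
      refine ⟨Finset.union_subset (hτ.1.trans Finset.sdiff_subset) h,
        Finset.subset_union_right, ?_⟩
      rw [Finset.card_union_of_disjoint, hτ.2]
      · omega
      · exact Finset.disjoint_of_subset_left hτ.1 Finset.sdiff_disjoint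
    · intro τ hτ
      simp only [Finset.mem_filter] at hτ
      exact Finset.sdiff_union_of_subset hτ.2.1
    · intro τ hτ
      simp only [Finset.mem_powersetCard] at hτ
      exact Finset.union_sdiff_cancel_right
        (Finset.disjoint_of_subset_left hτ.1 Finset.sdiff_disjoint)
  · rw [Finset.filter_false_of_mem]
    · simp
    · rintro τ - ⟨h1, rfl⟩
      exact hi (Finset.card_le_card h1)

/-- `R` assigns to every facet `σ ∈ S` its restriction, such that the intervals `[R σ, σ]`
partition the family `T`. -/
structure IsPartitioning (T S : Finset (Finset X)) (R : Finset X → Finset X) (D : ℕ) : Prop where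
  card_eq : ∀ σ ∈ S, σ.card = D
  restriction_subset : ∀ σ ∈ S, R σ ⊆ σ
  mem_of_between : ∀ σ ∈ S, ∀ τ, R σ ⊆ τ → τ ⊆ σ → τ ∈ T
  exists_between : ∀ τ ∈ T, ∃ σ ∈ S, R σ ⊆ τ ∧ τ ⊆ σ
  unique_between : ∀ τ ∈ T, ∀ σ ∈ S, ∀ σ' ∈ S,
    R σ ⊆ τ → τ ⊆ σ → R σ' ⊆ τ → τ ⊆ σ' → σ = σ'

variable {T S : Finset (Finset X)} {R : Finset X → Finset X} {D : ℕ}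

lemma IsPartitioning.card_filter_card (h : IsPartitioning T S R D) (i : ℕ) :
    (({τ ∈ T | τ.card = i} : Finset (Finset X)).card : ℤ) =
      ∑ σ ∈ S, intervalCount D (R σ).card i := by
  have hT : ({τ ∈ T | τ.card = i} : Finset (Finset X)) =
      S.biUnion fun σ => {τ ∈ σ.powerset | R σ ⊆ τ ∧ τ.card = i} := by
    ext τ
    simp only [Finset.mem_filter, Finset.mem_biUnion, Finset.mem_powerset]
    constructor
    · rintro ⟨hτ, hc⟩
      obtain ⟨σ, hσ, h1, h2⟩ := h.exists_between τ hτ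
      exact ⟨σ, hσ, h2, h1, hc⟩
    · rintro ⟨σ, hσ, h2, h1, hc⟩
      exact ⟨h.mem_of_between σ hσ τ h1 h2, hc⟩
  rw [hT, Finset.card_biUnion]
  · push_cast
    refine Finset.sum_congr rfl fun σ hσ => ?_
    rw [card_interval_eq_intervalCount (h.restriction_subset σ hσ), h.card_eq σ hσ]
  · intro σ hσ σ' hσ' hne
    refine Finset.disjoint_left.2 fun τ h1 h2 => ?_
    simp only [Finset.mem_filter, Finset.mem_powerset] at h1 h2
    exact hne (h.unique_between τ (h.mem_of_between σ hσ τ h1.2.1 h1.1) σ hσ σ' hσ'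
      h1.2.1 h1.1 h2.2.1 h2.1)

lemma IsPartitioning.hTransform_eq (h : IsPartitioning T S R D) {k : ℕ} (hk : k ≤ D) :
    hTransform D k (fun i => (({τ ∈ T | τ.card = i} : Finset (Finset X)).card : ℤ)) =
      (({σ ∈ S | (R σ).card = k} : Finset (Finset X)).card : ℤ) := by
  simp only [h.card_filter_card]
  rw [hTransform_sum]
  simp only [hTransform_intervalCount hk]
  simp

/-- Passing to the star of a vertex. -/
lemma IsPartitioning.star (h : IsPartitioning T S R D) (v : X) :
    IsPartitioning {τ ∈ T | v ∈ τ} {σ ∈ S | v ∈ σ} (fun σ => insert v (R σ)) D where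
  card_eq σ hσ := h.card_eq σ (Finset.mem_filter.1 hσ).1
  restriction_subset σ hσ := by
    rw [Finset.mem_filter] at hσ
    exact Finset.insert_subset hσ.2 (h.restriction_subset σ hσ.1)
  mem_of_between σ hσ τ h1 h2 := by
    rw [Finset.mem_filter] at hσ ⊢
    rw [Finset.insert_subset_iff] at h1
    exact ⟨h.mem_of_between σ hσ.1 τ h1.2 h2, h1.1⟩
  exists_between τ hτ := by
    rw [Finset.mem_filter] at hτ
    obtain ⟨σ, hσ, h1, h2⟩ := h.exists_between τ hτ.1
    exact ⟨σ, Finset.mem_filter.2 ⟨hσ, h2 hτ.2⟩, Finset.insert_subset hτ.2 h1, h2⟩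
  unique_between τ hτ σ hσ σ' hσ' h1 h2 h3 h4 := by
    rw [Finset.mem_filter] at hτ hσ hσ'
    rw [Finset.insert_subset_iff] at h1 h3
    exact h.unique_between τ hτ.1 σ hσ.1 σ' hσ'.1 h1.2 h2 h3.2 h4

lemma IsPartitioning.hTransform_link_le {d : ℕ} (h : IsPartitioning T S R (d + 1)) {v : X}
    (hv : ∀ σ ∈ S, v ∈ σ → v ∉ R σ) {k : ℕ} (hk : k ≤ d) :
    hTransform d k
        (fun i => (({τ ∈ T | v ∈ τ ∧ τ.card = i + 1} : Finset (Finset X)).card : ℤ)) ≤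
      hTransform (d + 1) k
        (fun i => (({τ ∈ T | τ.card = i} : Finset (Finset X)).card : ℤ)) := by
  have hshift : ∀ r i, intervalCount (d + 1) (r + 1) (i + 1) = intervalCount d r i := by
    intro r i
    simp [intervalCount]
  have hcount : ∀ i, (({τ ∈ T | v ∈ τ ∧ τ.card = i + 1} : Finset (Finset X)).card : ℤ) =
      ∑ σ ∈ S with v ∈ σ, intervalCount d (R σ).card i := by
    intro i
    rw [← Finset.filter_filter, (h.star v).card_filter_card]
    refine Finset.sum_congr rfl fun σ hσ => ?_
    rw [Finset.mem_filter] at hσ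
    rw [Finset.card_insert_of_notMem (hv σ hσ.1 hσ.2), hshift]
  simp only [hcount]
  rw [hTransform_sum, h.hTransform_eq (by omega)]
  simp only [hTransform_intervalCount hk]
  rw [Finset.sum_boole, Nat.cast_le]
  exact Finset.card_le_card (Finset.filter_subset_filter _ (Finset.filter_subset _ _))

end Partition

section PolarFaces

open Filter Topology

variable {X E : Type*} [NormedAddCommGroup E] [NormedSpace ℝ E]

/-- `τ` is the set of points of `V` lying in a face of the convex hull of the vectors `y x`,
`x ∈ V`: the face is cut out by a functional `f` which is at most `1` on `V`. -/
def IsPolarFace (y : X → E) (V τ : Finset X) : Prop :=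
  τ ⊆ V ∧ ∃ f : E →ₗ[ℝ] ℝ, (∀ x ∈ V, f (y x) ≤ 1) ∧ ∀ x ∈ V, f (y x) = 1 ↔ x ∈ τ

lemma eq_one_of_sum_le_sum_mul {s : Finset X} {a g : X → ℝ} (ha : ∀ x ∈ s, 0 ≤ a x)
    (hg : ∀ x ∈ s, g x ≤ 1) (h : ∑ x ∈ s, a x ≤ ∑ x ∈ s, a x * g x) {x : X} (hx : x ∈ s)
    (hax : 0 < a x) : g x = 1 := by
  have hnn : ∀ z ∈ s, 0 ≤ a z * (1 - g z) := fun z hz =>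
    mul_nonneg (ha z hz) (sub_nonneg.2 (hg z hz))
  have hsum : ∑ z ∈ s, a z * (1 - g z) = 0 := by
    refine le_antisymm ?_ (Finset.sum_nonneg hnn)
    simp only [mul_sub, mul_one, Finset.sum_sub_distrib]
    linarith
  have := (Finset.sum_eq_zero_iff_of_nonneg hnn).1 hsum x hx
  rcases mul_eq_zero.1 this with h0 | h0 <;> linarith

lemma map_sum_smul (f : E →ₗ[ℝ] ℝ) (s : Finset X) (a : X → ℝ) (y : X → E) :
    f (∑ x ∈ s, a x • y x) = ∑ x ∈ s, a x * f (y x) := by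
  simp [map_sum]

lemma sum_mul_le_sum {s : Finset X} {a g : X → ℝ} (ha : ∀ x ∈ s, 0 ≤ a x)
    (hg : ∀ x ∈ s, g x ≤ 1) : ∑ x ∈ s, a x * g x ≤ ∑ x ∈ s, a x :=
  Finset.sum_le_sum fun x hx => mul_le_of_le_one_right (ha x hx) (hg x hx)

lemma exists_sum_smul_of_span_eq_top {y : X → E} {s : Finset X}
    (h : Submodule.span ℝ (y '' s) = ⊤) (p : E) : ∃ a : X → ℝ, ∑ x ∈ s, a x • y x = p :=
  (Submodule.mem_span_image_finset_iff_exists_fun' ℝ).1 (h ▸ Submodule.mem_top)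

lemma sum_smul_mem_span (y : X → E) (s : Finset X) (a : X → ℝ) :
    ∑ x ∈ s, a x • y x ∈ Submodule.span ℝ (y '' s) :=
  (Submodule.mem_span_image_finset_iff_exists_fun' ℝ).2 ⟨a, rfl⟩

lemma coeff_eq_of_sum_eq {y : X → E} {s : Finset X} (h : LinearIndepOn ℝ y (s : Set X))
    {a b : X → ℝ} (hab : ∑ x ∈ s, a x • y x = ∑ x ∈ s, b x • y x) {x : X} (hx : x ∈ s) :
    a x = b x := by
  have := linearIndepOn_finset_iff.1 h (fun x => a x - b x)
    (by simp [sub_smul, hab]) x hx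
  linarith

lemma exists_linearMap_of_linearIndepOn {y : X → E} {s : Finset X}
    (h : LinearIndepOn ℝ y (s : Set X)) (hs : Submodule.span ℝ (y '' s) = ⊤) (g : X → ℝ) :
    ∃ f : E →ₗ[ℝ] ℝ, ∀ x ∈ s, f (y x) = g x := by
  let b := Module.Basis.mk h (by rw [← Set.image_eq_range]; exact hs.ge)
  refine ⟨b.constr ℝ fun x => g x, fun x hx => ?_⟩
  have := b.constr_basis ℝ (fun x : (s : Set X) => g x) ⟨x, hx⟩
  simpa [b] using this

lemma card_eq_finrank_of_linearIndepOn [FiniteDimensional ℝ E] {y : X → E} {s : Finset X}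
    (h : LinearIndepOn ℝ y (s : Set X)) :
    Submodule.span ℝ (y '' s) = ⊤ ↔ s.card = Module.finrank ℝ E := by
  constructor
  · intro hs
    let b := Module.Basis.mk h (by rw [← Set.image_eq_range]; exact hs.ge)
    have := Module.finrank_eq_card_basis b
    simpa using this.symm
  · intro hc
    rw [Set.image_eq_range]
    exact LinearIndependent.span_eq_top_of_card_eq_finrank' h (by simpa using hc)

/-- A subset of a simplicial facet is the vertex set of a face. -/
lemma IsPolarFace.of_subset {y : X → E} {V σ τ : Finset X} (hσ : IsPolarFace y V σ)
    (hli : LinearIndepOn ℝ y (σ : Set X)) (hspan : Submodule.span ℝ (y '' σ) = ⊤)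
    (hτ : τ ⊆ σ) : IsPolarFace y V τ := by
  classical
  obtain ⟨hσV, f, hf1, hf2⟩ := hσ
  obtain ⟨g, hg⟩ := exists_linearMap_of_linearIndepOn hli hspan fun x => if x ∈ τ then 0 else -1
  have hsmall : ∀ᶠ δ : ℝ in 𝓝[>] 0, ∀ x ∈ V, x ∉ σ → f (y x) + δ * g (y x) < 1 := by
    refine (eventually_all_finset V).2 fun x hx => ?_
    by_cases hxσ : x ∈ σ
    · simp [hxσ]
    have hlt : f (y x) < 1 := lt_of_le_of_ne (hf1 x hx) fun h => hxσ ((hf2 x hx).1 h)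
    have hcont : Tendsto (fun δ : ℝ => f (y x) + δ * g (y x)) (𝓝[>] 0) (𝓝 (f (y x))) := by
      have : Continuous fun δ : ℝ => f (y x) + δ * g (y x) := by fun_prop
      simpa using (this.tendsto 0).mono_left nhdsWithin_le_nhds
    filter_upwards [hcont.eventually (gt_mem_nhds hlt)] with δ hδ _ using hδ
  obtain ⟨δ, hδ, hδ0⟩ := (hsmall.and self_mem_nhdsWithin).exists
  have hval : ∀ x ∈ σ, f (y x) + δ * g (y x) = if x ∈ τ then 1 else 1 - δ := by
    intro x hx
    rw [hg x hx, (hf2 x (hσV hx)).2 hx]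
    split_ifs <;> ring
  refine ⟨hτ.trans hσV, f + δ • g, fun x hx => ?_, fun x hx => ?_⟩
  · by_cases hxσ : x ∈ σ
    · simp only [LinearMap.add_apply, LinearMap.smul_apply, smul_eq_mul, hval x hxσ]
      split_ifs <;> linarith
    · exact (hδ x hx hxσ).le
  · by_cases hxσ : x ∈ σ
    · simp only [LinearMap.add_apply, LinearMap.smul_apply, smul_eq_mul, hval x hxσ]
      split_ifs with h
      · simp [h]
      · simp [h, hδ0.ne']
    · exact iff_of_false (hδ x hx hxσ).ne fun h => hxσ (hτ h)

lemma eventually_add_smul_notMem {q s : E} {W : Submodule ℝ E} (h : q ∉ W ∨ s ∉ W) :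
    ∀ᶠ δ : ℝ in 𝓝[>] 0, q + δ • s ∉ W := by
  by_cases hs : s ∈ W
  · have hq : q ∉ W := h.resolve_right fun h' => h' hs
    filter_upwards with δ hδ
    exact hq ((Submodule.add_mem_iff_left W (W.smul_mem δ hs)).1 hδ)
  by_cases hex : ∃ δ₀ : ℝ, 0 < δ₀ ∧ q + δ₀ • s ∈ W
  · obtain ⟨δ₀, hδ₀, hmem⟩ := hex
    filter_upwards [Ioo_mem_nhdsGT hδ₀] with δ hδ hmem'
    have : (δ₀ - δ) • s ∈ W := by
      have := W.sub_mem hmem hmem'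
      rwa [add_sub_add_left_eq_sub, ← sub_smul] at this
    exact hs ((W.smul_mem_iff (sub_pos.2 hδ.2).ne').1 this)
  · push Not at hex
    filter_upwards [self_mem_nhdsWithin] with δ hδ using hex δ hδ

/-- A spanning finite family has a nonnegative combination avoiding finitely many proper
subspaces. -/
lemma exists_nonneg_combination_notMem {y : X → E} {A : Finset X}
    (hA : Submodule.span ℝ (y '' A) = ⊤) (𝒲 : Finset (Submodule ℝ E)) (h𝒲 : ∀ W ∈ 𝒲, W ≠ ⊤) :
    ∃ e : X → ℝ, (∀ x ∈ A, 0 ≤ e x) ∧ ∀ W ∈ 𝒲, ∑ x ∈ A, e x • y x ∉ W := by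
  classical
  induction 𝒲 using Finset.induction_on with
  | empty => exact ⟨0, by simp, by simp⟩
  | insert W 𝒲 _ ih =>
    obtain ⟨e, he, hav⟩ := ih fun W' hW' => h𝒲 W' (Finset.mem_insert_of_mem hW')
    obtain ⟨s, hsA, hsW⟩ : ∃ s ∈ A, y s ∉ W := by
      by_contra! hcon
      refine h𝒲 W (Finset.mem_insert_self _ _) (top_le_iff.1 (hA ▸ Submodule.span_le.2 ?_))
      rintro _ ⟨x, hx, rfl⟩
      exact hcon x hx
    have hev : ∀ᶠ δ : ℝ in 𝓝[>] 0, ∀ W' ∈ insert W 𝒲, ∑ x ∈ A, e x • y x + δ • y s ∉ W' := by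
      refine (eventually_all_finset _).2 fun W' hW' => eventually_add_smul_notMem ?_
      rcases Finset.mem_insert.1 hW' with rfl | hW'
      · exact Or.inr hsW
      · exact Or.inl (hav W' hW')
    obtain ⟨δ, hδ, hδ0⟩ := (hev.and self_mem_nhdsWithin).exists
    refine ⟨fun x => e x + if x = s then δ else 0, fun x hx => ?_, fun W' hW' => ?_⟩
    · have := he x hx
      dsimp only
      split_ifs <;> linarith
    · convert hδ W' hW' using 1
      simp [add_smul, Finset.sum_add_distrib, ite_smul, hsA]

variable [FiniteDimensional ℝ E]

/-- If the vectors `y x`, `x ∈ V`, positively span the space then every vector lies in the cone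
over some face of their convex hull. -/
lemma exists_polarFace_cone {y : X → E} (hy : Function.Injective y) {V : Finset X}
    (hpos : ∀ p : E, ∃ a : X → ℝ, (∀ x ∈ V, 0 ≤ a x) ∧ ∑ x ∈ V, a x • y x = p) (p : E) :
    ∃ τ, IsPolarFace y V τ ∧ ∃ a : X → ℝ, (∀ x ∈ τ, 0 ≤ a x) ∧ ∑ x ∈ τ, a x • y x = p := by
  classical
  rcases eq_or_ne p 0 with rfl | hp
  · exact ⟨∅, ⟨by simp, 0, by simp, by simp⟩, 0, by simp, by simp⟩
  have hdual : ∀ f : E →ₗ[ℝ] ℝ, (∀ x ∈ V, f (y x) ≤ 0) → f = 0 := by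
    intro f hf
    have hle : ∀ q, f q ≤ 0 := by
      intro q
      obtain ⟨a, ha, rfl⟩ := hpos q
      rw [map_sum_smul]
      exact Finset.sum_nonpos fun x hx => mul_nonpos_of_nonneg_of_nonpos (ha x hx) (hf x hx)
    ext q
    refine le_antisymm (hle q) ?_
    have := hle (-q)
    rw [map_neg] at this
    simpa using this
  set C : Set E := convexHull ℝ (V.image y : Set E) with hC
  have hyC : ∀ x ∈ V, y x ∈ C := fun x hx =>
    subset_convexHull ℝ _ (by simpa using ⟨x, hx, rfl⟩)
  have hCcompact : IsCompact C := (Finset.finite_toSet _).isCompact_convexHull (𝕜 := ℝ)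
  have hCconv : Convex ℝ C := convex_convexHull ℝ _
  have h0C : (0 : E) ∈ C := by
    obtain ⟨a, ha, hap⟩ := hpos p
    obtain ⟨b, hb, hbp⟩ := hpos (-p)
    have hpos' : 0 < ∑ x ∈ V, (a x + b x) := by
      refine lt_of_le_of_ne (Finset.sum_nonneg fun x hx => add_nonneg (ha x hx) (hb x hx)) ?_
      intro h0
      have hz := (Finset.sum_eq_zero_iff_of_nonneg
        fun x hx => add_nonneg (ha x hx) (hb x hx)).1 h0.symm
      refine hp (hap ▸ Finset.sum_eq_zero fun x hx => ?_)
      have h1 := hz x hx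
      have h2 := ha x hx
      have h3 := hb x hx
      rw [show a x = 0 by linarith, zero_smul]
    have hmem := Finset.centerMass_mem_convexHull (R := ℝ) (s := (V.image y : Set E)) V
      (w := fun x => a x + b x) (z := y) (fun x hx => add_nonneg (ha x hx) (hb x hx)) hpos'
      (fun x hx => by simpa using ⟨x, hx, rfl⟩)
    simpa [hC, Finset.centerMass, add_smul, Finset.sum_add_distrib, hap, hbp] using hmem
  have hspan : affineSpan ℝ (V.image y : Set E) = ⊤ := by
    have h0 : (0 : E) ∈ affineSpan ℝ (V.image y : Set E) := convexHull_subset_affineSpan _ h0C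
    rw [← affineSpan_insert_eq_affineSpan ℝ h0]
    refine SetLike.coe_injective ?_
    rw [affineSpan_insert_zero, AffineSubspace.top_coe, Set.eq_univ_iff_forall]
    intro q
    obtain ⟨a, -, rfl⟩ := hpos q
    exact Submodule.sum_mem _ fun x hx => Submodule.smul_mem _ _
      (Submodule.subset_span (by simpa using ⟨x, hx, rfl⟩))
  have hint : (interior C).Nonempty := interior_convexHull_nonempty_iff_affineSpan_eq_top.2 hspan
  have hK : IsCompact ((fun t : ℝ => t • p) ⁻¹' C ∩ Set.Ici 0) :=
    ((isClosedEmbedding_smul_left hp).isCompact_preimage hCcompact).inter_right isClosed_Ici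
  obtain ⟨t, ⟨htC, ht0⟩, htmax⟩ := hK.exists_isGreatest ⟨0, by simpa using h0C, by simp⟩
  have ht0' : 0 ≤ t := ht0
  have htint : t • p ∉ interior C := by
    intro hmem
    have hcont : Tendsto (fun s : ℝ => s • p) (𝓝[>] t) (𝓝 (t • p)) := by
      have : Continuous fun s : ℝ => s • p := by fun_prop
      exact (this.tendsto t).mono_left nhdsWithin_le_nhds
    obtain ⟨s, hs, hst⟩ :=
      ((hcont.eventually (mem_interior_iff_mem_nhds.1 hmem)).and self_mem_nhdsWithin).exists
    exact absurd (htmax ⟨hs, (ht0'.trans hst.le : (0 : ℝ) ≤ s)⟩) (not_le.2 hst)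
  obtain ⟨f, hf⟩ := geometric_hahn_banach_open_point hCconv.interior isOpen_interior htint
  have hfC : ∀ c ∈ C, f c ≤ f (t • p) := by
    have hsub : closure (interior C) ⊆ {c | f c ≤ f (t • p)} :=
      closure_minimal (fun c hc => (hf c hc).le) (isClosed_le f.continuous continuous_const)
    rw [hCconv.closure_interior_eq_closure_of_nonempty_interior hint] at hsub
    exact fun c hc => hsub (subset_closure hc)
  have hfpos : 0 < f (t • p) := by
    by_contra! hle
    have hzero : (f : E →ₗ[ℝ] ℝ) = 0 := hdual f fun x hx => (hfC _ (hyC x hx)).trans hle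
    have hz : ∀ c, f c = 0 := fun c => by simpa using LinearMap.congr_fun hzero c
    obtain ⟨c, hc⟩ := hint
    have := hf c hc
    rw [hz, hz] at this
    exact lt_irrefl _ this
  have htpos : 0 < t := by
    refine lt_of_le_of_ne ht0' ?_
    rintro rfl
    simp at hfpos
  set g : E →ₗ[ℝ] ℝ := (f (t • p))⁻¹ • (f : E →ₗ[ℝ] ℝ) with hg
  have hgV : ∀ x ∈ V, g (y x) ≤ 1 := by
    intro x hx
    simp only [hg, LinearMap.smul_apply, smul_eq_mul]
    rw [inv_mul_le_iff₀ hfpos, mul_one]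
    exact hfC _ (hyC x hx)
  have hgt : g (t • p) = 1 := by
    simp only [hg, LinearMap.smul_apply, smul_eq_mul]
    exact inv_mul_cancel₀ hfpos.ne'
  obtain ⟨w, hw0, hw1, hwp⟩ := Finset.mem_convexHull'.1 htC
  rw [Finset.sum_image hy.injOn] at hw1 hwp
  have hw0' : ∀ x ∈ V, 0 ≤ w (y x) := fun x hx => hw0 _ (Finset.mem_image_of_mem y hx)
  refine ⟨{x ∈ V | g (y x) = 1}, ⟨Finset.filter_subset _ _, g, hgV, by simp +contextual⟩,
    fun x => t⁻¹ * w (y x), fun x hx => ?_, ?_⟩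
  · exact mul_nonneg (inv_nonneg.2 htpos.le) (hw0' x (Finset.mem_filter.1 hx).1)
  · have hzero : ∀ x ∈ V, g (y x) ≠ 1 → w (y x) = 0 := by
      intro x hx hne
      by_contra hwx
      refine hne (eq_one_of_sum_le_sum_mul (a := fun x => w (y x)) (g := fun x => g (y x))
        hw0' hgV ?_ hx (lt_of_le_of_ne (hw0' x hx) (Ne.symm hwx)))
      rw [hw1, ← map_sum_smul g V (fun x => w (y x)) y, hwp, hgt]
    rw [Finset.sum_filter_of_ne fun x hx hne => ?_]
    · simp only [mul_smul]
      rw [← Finset.smul_sum, hwp, inv_smul_smul₀ htpos.ne']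
    · by_contra h1
      exact hne (by simp [hzero x hx h1])

end PolarFaces

section PolarCayley

open Filter Topology

variable {X E : Type*} [NormedAddCommGroup E] [NormedSpace ℝ E]

/-- The vertices of `σ` at which the direction `u` has a negative coordinate. -/
def restrictionSet (y : X → E) (u : E) (σ : Finset X) : Finset X :=
  open Classical in {x ∈ σ | ∃ c : X → ℝ, ∑ z ∈ σ, c z • y z = u ∧ c x < 0}

lemma restrictionSet_subset (y : X → E) (u : E) (σ : Finset X) : restrictionSet y u σ ⊆ σ := by
  classical exact Finset.filter_subset _ _

lemma eventually_pos_add_mul {a : ℝ} (ha : 0 < a) (b : ℝ) : ∀ᶠ δ : ℝ in 𝓝[>] 0, 0 < a + δ * b := by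
  have hcont : Tendsto (fun δ : ℝ => a + δ * b) (𝓝[>] 0) (𝓝 a) := by
    have : Continuous fun δ : ℝ => a + δ * b := by fun_prop
    simpa using (this.tendsto 0).mono_left nhdsWithin_le_nhds
  exact hcont.eventually (lt_mem_nhds ha)

lemma le_of_frequently_add_mul_le {a b c d : ℝ}
    (h : ∃ᶠ ε : ℝ in 𝓝[>] 0, a + ε * b ≤ c + ε * d) : a ≤ c := by
  by_contra! hlt
  refine h ?_
  filter_upwards [eventually_pos_add_mul (sub_pos.2 hlt) (b - d)] with ε hε hle
  linarith

variable [DecidableEq X]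

/-- The vectors of a Cayley polytope with facets `A` and `B`, seen from the midpoint of a vertex
`v` of `A` and the centroid of `B`. -/
structure IsPolarCayley (y : X → E) (A B : Finset X) (v : X) : Prop where
  injective : Function.Injective y
  disjoint : Disjoint A B
  isPolarFace_left : IsPolarFace y (A ∪ B) A
  isPolarFace_right : IsPolarFace y (A ∪ B) B
  mem_left : v ∈ A
  span_left : Submodule.span ℝ (y '' A) = ⊤
  span_right : Submodule.span ℝ (y '' B) = ⊤
  balanced : ∃ κ : ℝ, 0 < κ ∧ y v + ∑ x ∈ B, κ • y x = 0
  linearIndepOn : ∀ σ, IsPolarFace y (A ∪ B) σ → σ ≠ A → σ ≠ B →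
    LinearIndepOn ℝ y (σ : Set X)

open Classical in
/-- The faces other than `B` which have a vertex in `B`. -/
def facesMeeting (y : X → E) (A B : Finset X) : Finset (Finset X) :=
  {τ ∈ (A ∪ B).powerset | IsPolarFace y (A ∪ B) τ ∧ τ ≠ B ∧ (τ ∩ B).Nonempty}

/-- A direction close to `v`, in the cone over `A`, opposite to the relative interior of the
cone over `B`, and otherwise generic. -/
structure IsSweepDirection (y : X → E) (A B : Finset X) (v : X) (u : E) : Prop where
  mem_cone_left : ∃ e : X → ℝ, (∀ x ∈ A, 0 ≤ e x) ∧ ∑ x ∈ A, e x • y x = u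
  neg_mem_cone_right : ∃ e : X → ℝ, (∀ x ∈ B, 0 < e x) ∧ ∑ x ∈ B, e x • y x = -u
  generic : ∀ τ ⊆ A ∪ B, Submodule.span ℝ (y '' τ) ≠ ⊤ → u ∉ Submodule.span ℝ (y '' τ)
  coeff_pos : ∀ σ ⊆ A ∪ B, LinearIndepOn ℝ y (σ : Set X) → Submodule.span ℝ (y '' σ) = ⊤ →
    v ∈ σ → ∀ c : X → ℝ, ∑ x ∈ σ, c x • y x = u → 0 < c v

lemma subset_of_mem_facesMeeting {y : X → E} {A B τ : Finset X} (hτ : τ ∈ facesMeeting y A B) :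
    τ ⊆ A ∪ B := by
  simp only [facesMeeting, Finset.mem_filter, Finset.mem_powerset] at hτ
  exact hτ.1

namespace IsPolarCayley

variable {y : X → E} {A B : Finset X} {v : X}

lemma positive_span (h : IsPolarCayley y A B v) (p : E) :
    ∃ a : X → ℝ, (∀ x ∈ A ∪ B, 0 ≤ a x) ∧ ∑ x ∈ A ∪ B, a x • y x = p := by
  obtain ⟨κ, hκ, hbal⟩ := h.balanced
  obtain ⟨b, hb⟩ := exists_sum_smul_of_span_eq_top h.span_right p
  obtain ⟨M, hM0, hM⟩ : ∃ M : ℝ, 0 ≤ M ∧ ∀ x ∈ B, 0 ≤ b x + M * κ := by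
    refine ⟨∑ x ∈ B, |b x| / κ, Finset.sum_nonneg fun x _ => by positivity, fun x hx => ?_⟩
    have h1 : |b x| / κ ≤ ∑ x ∈ B, |b x| / κ :=
      Finset.single_le_sum (f := fun x => |b x| / κ) (fun z _ => by positivity) hx
    have h2 : |b x| ≤ (∑ x ∈ B, |b x| / κ) * κ := by
      rwa [← div_le_iff₀ hκ]
    linarith [neg_abs_le (b x)]
  have hvB : v ∉ B := Finset.disjoint_left.1 h.disjoint h.mem_left
  refine ⟨fun x => if x ∈ B then b x + M * κ else if x = v then M else 0, fun x _ => ?_, ?_⟩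
  · dsimp only
    split_ifs with h1 h2
    · exact hM x h1
    · exact hM0
    · exact le_rfl
  · rw [Finset.sum_union h.disjoint]
    have hsA : ∑ x ∈ A, (if x ∈ B then b x + M * κ else if x = v then M else 0) • y x =
        M • y v := by
      rw [Finset.sum_eq_single v]
      · simp [hvB]
      · intro x hx hne
        simp [Finset.disjoint_left.1 h.disjoint hx, hne]
      · exact fun hv => absurd h.mem_left hv
    have hsB : ∑ x ∈ B, (if x ∈ B then b x + M * κ else if x = v then M else 0) • y x =
        p + M • ∑ x ∈ B, κ • y x := by
      rw [← hb, Finset.smul_sum, ← Finset.sum_add_distrib]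
      refine Finset.sum_congr rfl fun x hx => ?_
      rw [if_pos hx, add_smul, mul_smul]
    rw [hsA, hsB, eq_neg_of_add_eq_zero_right hbal]
    simp

lemma exists_isSweepDirection (h : IsPolarCayley y A B v) :
    ∃ u, IsSweepDirection y A B v u := by
  classical
  obtain ⟨κ, hκ, hbal⟩ := h.balanced
  set 𝒲 : Finset (Submodule ℝ E) :=
    ({τ ∈ (A ∪ B).powerset | Submodule.span ℝ (y '' τ) ≠ ⊤} : Finset (Finset X)).image
      fun τ : Finset X => Submodule.span ℝ (y '' τ)
  obtain ⟨e, he, hav⟩ := exists_nonneg_combination_notMem h.span_left 𝒲 (by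
    intro W hW
    simp only [𝒲, Finset.mem_image, Finset.mem_filter] at hW
    obtain ⟨τ, hτ, rfl⟩ := hW
    exact hτ.2)
  set q := ∑ x ∈ A, e x • y x with hq
  have hgen : ∀ᶠ δ : ℝ in 𝓝[>] 0, ∀ W ∈ 𝒲, y v + δ • q ∉ W :=
    (eventually_all_finset _).2 fun W hW => eventually_add_smul_notMem (Or.inr (hav W hW))
  obtain ⟨b, hb⟩ := exists_sum_smul_of_span_eq_top h.span_right q
  have hneg : ∀ᶠ δ : ℝ in 𝓝[>] 0, ∀ x ∈ B, 0 < κ + δ * (-b x) :=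
    (eventually_all_finset _).2 fun x _ => eventually_pos_add_mul hκ _
  have hcoeff : ∀ᶠ δ : ℝ in 𝓝[>] 0, ∀ σ ∈ (A ∪ B).powerset, LinearIndepOn ℝ y (σ : Set X) →
      Submodule.span ℝ (y '' σ) = ⊤ → v ∈ σ →
      ∀ c : X → ℝ, ∑ x ∈ σ, c x • y x = y v + δ • q → 0 < c v := by
    refine (eventually_all_finset _).2 fun σ _ => ?_
    by_cases hσ : LinearIndepOn ℝ y (σ : Set X) ∧ Submodule.span ℝ (y '' σ) = ⊤ ∧ v ∈ σ
    · obtain ⟨hli, hspan, hvσ⟩ := hσ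
      obtain ⟨b', hb'⟩ := exists_sum_smul_of_span_eq_top hspan q
      filter_upwards [eventually_pos_add_mul one_pos (b' v)] with δ hδ _ _ _ c hc
      have : c v = (fun x => (if x = v then (1 : ℝ) else 0) + δ * b' x) v := by
        refine coeff_eq_of_sum_eq (a := c)
          (b := fun x => (if x = v then (1 : ℝ) else 0) + δ * b' x) hli ?_ hvσ
        rw [hc, ← hb']
        simp [add_smul, Finset.sum_add_distrib, mul_smul, Finset.smul_sum, hvσ]
      rw [this]
      simpa using hδ
    · exact Eventually.of_forall fun δ h1 h2 h3 => absurd ⟨h1, h2, h3⟩ hσ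
  obtain ⟨δ, ⟨⟨hgen, hneg⟩, hcoeff⟩, hδ⟩ :=
    (((hgen.and hneg).and hcoeff).and self_mem_nhdsWithin).exists
  replace hδ : 0 < δ := hδ
  refine ⟨y v + δ • q, ?_, ?_, ?_, fun σ hσ => hcoeff σ (Finset.mem_powerset.2 hσ)⟩
  · refine ⟨fun x => (if x = v then 1 else 0) + δ * e x, fun x hx => ?_, ?_⟩
    · have := mul_nonneg hδ.le (he x hx)
      dsimp only
      split_ifs <;> linarith
    · simp [add_smul, Finset.sum_add_distrib, mul_smul, Finset.smul_sum, h.mem_left, hq]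
  · refine ⟨fun x => κ + δ * (-b x), hneg, ?_⟩
    rw [eq_neg_of_add_eq_zero_left hbal, ← hb]
    simp [add_smul, Finset.sum_add_distrib, mul_smul, Finset.smul_sum, add_comm]
  · intro τ hτ hne
    exact hgen _ (Finset.mem_image_of_mem _
      (Finset.mem_filter.2 ⟨Finset.mem_powerset.2 hτ, hne⟩))

lemma linearIndepOn_of_mem (h : IsPolarCayley y A B v) {σ : Finset X}
    (hσ : σ ∈ facesMeeting y A B) : LinearIndepOn ℝ y (σ : Set X) := by
  simp only [facesMeeting, Finset.mem_filter] at hσ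
  refine h.linearIndepOn σ hσ.2.1 ?_ hσ.2.2.1
  rintro rfl
  rw [Finset.disjoint_iff_inter_eq_empty.1 h.disjoint] at hσ
  exact Finset.not_nonempty_empty hσ.2.2.2

variable [FiniteDimensional ℝ E] {u : E}

lemma exists_coeff (h : IsPolarCayley y A B v) (hu : IsSweepDirection y A B v u) {σ : Finset X}
    (hσ : σ ∈ facesMeeting y A B) (hcard : σ.card = Module.finrank ℝ E) :
    ∃ c : X → ℝ, ∑ x ∈ σ, c x • y x = u ∧ (∀ x ∈ σ, c x ≠ 0) ∧
      ∀ x ∈ σ, x ∈ restrictionSet y u σ ↔ c x < 0 := by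
  have hli := h.linearIndepOn_of_mem hσ
  have hspan := (card_eq_finrank_of_linearIndepOn hli).2 hcard
  obtain ⟨c, hc⟩ := exists_sum_smul_of_span_eq_top hspan u
  refine ⟨c, hc, fun x hx h0 => ?_, fun x hx => ?_⟩
  · have hσV : σ ⊆ A ∪ B := subset_of_mem_facesMeeting hσ
    have hlie : LinearIndepOn ℝ y ((σ.erase x : Finset X) : Set X) :=
      hli.mono (by simp)
    refine hu.generic (σ.erase x) ((Finset.erase_subset _ _).trans hσV) ?_ ?_
    · rw [Ne, card_eq_finrank_of_linearIndepOn hlie, Finset.card_erase_of_mem hx, ← hcard]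
      have := Finset.card_pos.2 ⟨x, hx⟩
      omega
    · rw [← hc, ← Finset.add_sum_erase _ _ hx, h0, zero_smul, zero_add]
      exact sum_smul_mem_span _ _ _
  · simp only [restrictionSet, Finset.mem_filter, hx, true_and]
    constructor
    · rintro ⟨c', hc', hlt⟩
      rwa [coeff_eq_of_sum_eq hli (hc.trans hc'.symm) hx]
    · exact fun hlt => ⟨c, hc, hlt⟩

lemma restriction_meets_right (h : IsPolarCayley y A B v) (hu : IsSweepDirection y A B v u)
    {σ : Finset X} (hσ : σ ∈ facesMeeting y A B) (hcard : σ.card = Module.finrank ℝ E) :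
    (restrictionSet y u σ ∩ B).Nonempty := by
  obtain ⟨c, hc, hc0, hR⟩ := h.exists_coeff hu hσ hcard
  by_contra hcon
  obtain ⟨e, he, heu⟩ := hu.mem_cone_left
  obtain ⟨-, α, hα1, hα⟩ := h.isPolarFace_left
  simp only [facesMeeting, Finset.mem_filter, Finset.mem_powerset] at hσ
  obtain ⟨hσV, ⟨-, f, hf1, hf⟩, -, x, hx⟩ := hσ
  rw [Finset.mem_inter] at hx
  have hcB : ∀ x ∈ σ, x ∈ B → 0 < c x := by
    intro x hx hxB
    refine lt_of_le_of_ne (not_lt.1 fun hlt => hcon ⟨x, ?_⟩) (hc0 x hx).symm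
    exact Finset.mem_inter.2 ⟨(hR x hx).2 hlt, hxB⟩
  have h1 : f u ≤ α u := by
    rw [← heu, map_sum_smul, map_sum_smul]
    refine Finset.sum_le_sum fun x hx => mul_le_mul_of_nonneg_left ?_ (he x hx)
    rw [(hα x (Finset.mem_union_left _ hx)).2 hx]
    exact hf1 x (Finset.mem_union_left _ hx)
  have h2 : α u < f u := by
    rw [← hc, map_sum_smul, map_sum_smul]
    have hle : ∀ x ∈ σ, x ∈ B → α (y x) < f (y x) := by
      intro x hx hxB
      rw [(hf x (hσV hx)).2 hx]
      exact lt_of_le_of_ne (hα1 x (hσV hx)) fun heq =>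
        Finset.disjoint_left.1 h.disjoint ((hα x (hσV hx)).1 heq) hxB
    refine Finset.sum_lt_sum (fun x hx => ?_)
      ⟨x, hx.1, mul_lt_mul_of_pos_left (hle x hx.1 hx.2) (hcB x hx.1 hx.2)⟩
    rcases Finset.mem_union.1 (hσV hx) with hxA | hxB
    · rw [(hα x (hσV hx)).2 hxA, (hf x (hσV hx)).2 hx]
    · exact mul_le_mul_of_nonneg_left (hle x hx hxB).le (hcB x hx hxB).le
  exact absurd h1 (not_le.2 h2)

lemma exists_between (h : IsPolarCayley y A B v) (hu : IsSweepDirection y A B v u)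
    {τ : Finset X} (hτ : τ ∈ facesMeeting y A B) :
    ∃ σ ∈ facesMeeting y A B, σ.card = Module.finrank ℝ E ∧ restrictionSet y u σ ⊆ τ ∧ τ ⊆ σ := by
  have hτ' := hτ
  simp only [facesMeeting, Finset.mem_filter, Finset.mem_powerset] at hτ'
  obtain ⟨hτV, ⟨-, g, hg1, hg⟩, hτB, hτmeet⟩ := hτ'
  have hgτ : ∀ x ∈ τ, g (y x) = 1 := fun x hx => (hg x (hτV hx)).2 hx
  set p := ∑ x ∈ τ, y x with hp
  have hgp : g p = τ.card := by
    rw [hp, map_sum, Finset.sum_congr rfl hgτ]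
    simp
  have hle_card : ∀ f : E →ₗ[ℝ] ℝ, (∀ x ∈ A ∪ B, f (y x) ≤ 1) → f p ≤ τ.card := by
    intro f hf
    rw [hp, map_sum]
    exact (Finset.sum_le_sum fun x hx => hf x (hτV hx)).trans (by simp)
  have hfreq : ∃ᶠ ε : ℝ in 𝓝[>] 0, ∃ H ∈ (A ∪ B).powerset, IsPolarFace y (A ∪ B) H ∧
      ∃ a : X → ℝ, (∀ x ∈ H, 0 ≤ a x) ∧ ∑ x ∈ H, a x • y x = p + ε • u := by
    refine Eventually.frequently (Eventually.of_forall fun ε => ?_)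
    obtain ⟨H, hH, ha⟩ := exists_polarFace_cone h.injective h.positive_span (p + ε • u)
    exact ⟨H, Finset.mem_powerset.2 hH.1, hH, ha⟩
  obtain ⟨H, hHV, hH⟩ :=
    (frequently_exists_finite (Finset.finite_toSet (A ∪ B).powerset)).1 hfreq
  obtain ⟨ε₀, hface, -⟩ := hH.exists
  replace hH : ∃ᶠ ε : ℝ in 𝓝[>] 0,
      ∃ a : X → ℝ, (∀ x ∈ H, 0 ≤ a x) ∧ ∑ x ∈ H, a x • y x = p + ε • u := hH.mono fun _ h => h.2
  obtain ⟨hHV', f, hf1, hf⟩ := id hface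
  have hfH : ∀ x ∈ H, f (y x) = 1 := fun x hx => (hf x (hHV' hx)).2 hx
  -- `f` takes the largest value at points of the cone over `H`
  have hmax : ∀ a : X → ℝ, (∀ x ∈ H, 0 ≤ a x) →
      g (∑ x ∈ H, a x • y x) ≤ f (∑ x ∈ H, a x • y x) := by
    intro a ha
    rw [map_sum_smul, map_sum_smul]
    refine Finset.sum_le_sum fun x hx => mul_le_mul_of_nonneg_left ?_ (ha x hx)
    rw [hfH x hx]
    exact hg1 x (hHV' hx)
  have hfp : (τ.card : ℝ) ≤ f p := by
    rw [← hgp]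
    refine le_of_frequently_add_mul_le (b := g u) (d := f u) (hH.mono ?_)
    rintro ε ⟨a, ha, hae⟩
    simpa [hae] using hmax a ha
  have hτH : τ ⊆ H := by
    intro x hx
    refine (hf x (hτV hx)).1 (eq_one_of_sum_le_sum_mul (s := τ) (a := fun _ => 1)
      (g := fun x => f (y x)) (by simp) (fun z hz => hf1 z (hτV hz)) ?_ hx one_pos)
    simpa [hp, map_sum] using hfp
  have hHA : H ≠ A := by
    rintro rfl
    obtain ⟨x, hx⟩ := hτmeet
    rw [Finset.mem_inter] at hx
    exact Finset.disjoint_left.1 h.disjoint (hτH hx.1) hx.2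
  have hHB : H ≠ B := by
    rintro rfl
    obtain ⟨ε, ⟨a, ha, hae⟩, hε⟩ := (hH.and_eventually self_mem_nhdsWithin).exists
    replace hε : 0 < ε := hε
    obtain ⟨e, he, heu⟩ := hu.neg_mem_cone_right
    have hpe : ∑ x ∈ H, (a x + ε * e x) • y x = p := by
      simp only [add_smul, mul_smul, Finset.sum_add_distrib, ← Finset.smul_sum, hae, heu]
      simp
    refine hτB (hτH.antisymm fun x hx => (hg x (hHV' hx)).1 ?_)
    have hpos : ∀ x ∈ H, 0 < a x + ε * e x := fun x hx =>
      add_pos_of_nonneg_of_pos (ha x hx) (mul_pos hε (he x hx))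
    refine eq_one_of_sum_le_sum_mul (s := H) (a := fun x => a x + ε * e x)
      (g := fun x => g (y x)) (fun x hx => (hpos x hx).le) (fun z hz => hg1 z (hHV' hz)) ?_ hx
      (hpos x hx)
    rw [← map_sum_smul g H (fun x => a x + ε * e x) y, hpe, hgp]
    refine le_trans (le_of_eq ?_) (hle_card f hf1)
    rw [← hpe, map_sum_smul]
    exact Finset.sum_congr rfl fun x hx => by rw [hfH x hx, mul_one]
  have hHmem : H ∈ facesMeeting y A B := by
    simp only [facesMeeting, Finset.mem_filter]
    exact ⟨hHV, hface, hHB, hτmeet.mono (Finset.inter_subset_inter_right hτH)⟩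
  have hli := h.linearIndepOn_of_mem hHmem
  have hpH : p = ∑ x ∈ H, (if x ∈ τ then (1 : ℝ) else 0) • y x := by
    simp [ite_smul, hp, Finset.inter_eq_right.2 hτH]
  have hspan : Submodule.span ℝ (y '' H) = ⊤ := by
    by_contra hne
    obtain ⟨ε, ⟨a, ha, hae⟩, hε⟩ := (hH.and_eventually self_mem_nhdsWithin).exists
    replace hε : 0 < ε := hε
    refine hu.generic H hHV' hne ?_
    have h1 : ε • u ∈ Submodule.span ℝ (y '' H) := by
      have : ε • u = ∑ x ∈ H, a x • y x - p := by rw [hae]; abel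
      rw [this, hpH]
      exact Submodule.sub_mem _ (sum_smul_mem_span _ _ _) (sum_smul_mem_span _ _ _)
    exact (Submodule.smul_mem_iff _ hε.ne').1 h1
  have hcard := (card_eq_finrank_of_linearIndepOn hli).1 hspan
  refine ⟨H, hHmem, hcard, ?_, hτH⟩
  obtain ⟨c, hc, -, hR⟩ := h.exists_coeff hu hHmem hcard
  intro x hx
  have hxH : x ∈ H := restrictionSet_subset y u H hx
  by_contra hxτ
  obtain ⟨ε, ⟨a, ha, hae⟩, hε⟩ := (hH.and_eventually self_mem_nhdsWithin).exists
  replace hε : 0 < ε := hε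
  have hax : a x = (fun x => (if x ∈ τ then (1 : ℝ) else 0) + ε * c x) x := by
    refine coeff_eq_of_sum_eq (a := a)
      (b := fun x => (if x ∈ τ then (1 : ℝ) else 0) + ε * c x) hli ?_ hxH
    rw [hae, hpH, ← hc]
    simp only [add_smul, mul_smul, Finset.sum_add_distrib, ← Finset.smul_sum]
  have h1 := ha x hxH
  rw [hax] at h1
  simp only [if_neg hxτ, zero_add] at h1
  exact absurd ((hR x hxH).1 hx) (not_lt.2 (nonneg_of_mul_nonneg_right h1 hε))

/-- For small `ε` the point `∑ x ∈ τ, y x + ε • u` lies in the interior of the cone over `σ`. -/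
lemma eventually_interior (h : IsPolarCayley y A B v) (hu : IsSweepDirection y A B v u)
    {σ τ : Finset X} (hσ : σ ∈ facesMeeting y A B) (hcard : σ.card = Module.finrank ℝ E)
    (hR : restrictionSet y u σ ⊆ τ) (hτ : τ ⊆ σ) :
    ∀ᶠ ε : ℝ in 𝓝[>] 0, ∃ a : X → ℝ, (∀ x ∈ σ, 0 < a x) ∧
      ∑ x ∈ σ, a x • y x = ∑ x ∈ τ, y x + ε • u := by
  obtain ⟨c, hc, hc0, hRc⟩ := h.exists_coeff hu hσ hcard
  have hev : ∀ᶠ ε : ℝ in 𝓝[>] 0, ∀ x ∈ σ, 0 < (if x ∈ τ then (1 : ℝ) else 0) + ε * c x := by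
    refine (eventually_all_finset _).2 fun x hx => ?_
    by_cases hxτ : x ∈ τ
    · simpa [hxτ] using eventually_pos_add_mul one_pos (c x)
    · filter_upwards [self_mem_nhdsWithin] with ε hε
      have : 0 < c x := lt_of_le_of_ne
        (not_lt.1 fun hlt => hxτ (hR ((hRc x hx).2 hlt))) (hc0 x hx).symm
      simpa [hxτ] using mul_pos hε this
  filter_upwards [hev] with ε hε
  refine ⟨_, hε, ?_⟩
  simp only [add_smul, mul_smul, Finset.sum_add_distrib, ← Finset.smul_sum, hc]
  simp [ite_smul, Finset.inter_eq_right.2 hτ]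

lemma eq_of_between (h : IsPolarCayley y A B v) (hu : IsSweepDirection y A B v u)
    {σ σ' τ : Finset X} (hσ : σ ∈ facesMeeting y A B) (hcard : σ.card = Module.finrank ℝ E)
    (hR : restrictionSet y u σ ⊆ τ) (hτ : τ ⊆ σ)
    (hσ' : σ' ∈ facesMeeting y A B) (hcard' : σ'.card = Module.finrank ℝ E)
    (hR' : restrictionSet y u σ' ⊆ τ) (hτ' : τ ⊆ σ') : σ = σ' := by
  obtain ⟨ε, ⟨a, ha, hae⟩, b, hb, hbe⟩ :=
    ((h.eventually_interior hu hσ hcard hR hτ).and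
      (h.eventually_interior hu hσ' hcard' hR' hτ')).exists
  simp only [facesMeeting, Finset.mem_filter] at hσ hσ'
  obtain ⟨hσV, f, hf1, hf⟩ := hσ.2.1
  obtain ⟨hσV', f', hf1', hf'⟩ := hσ'.2.1
  refine Finset.eq_of_subset_of_card_le (fun x hx => (hf' x (hσV hx)).1 ?_)
    (hcard'.trans hcard.symm).le
  refine eq_one_of_sum_le_sum_mul (s := σ) (a := a) (g := fun x => f' (y x))
    (fun x hx => (ha x hx).le) (fun z hz => hf1' z (hσV hz)) ?_ hx (ha x hx)
  have h1 : ∑ x ∈ σ, a x = f (∑ x ∈ σ, a x • y x) := by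
    rw [map_sum_smul]
    exact Finset.sum_congr rfl fun x hx => by rw [(hf x (hσV hx)).2 hx, mul_one]
  have h2 : f' (∑ x ∈ σ', b x • y x) = ∑ x ∈ σ', b x := by
    rw [map_sum_smul]
    exact Finset.sum_congr rfl fun x hx => by rw [(hf' x (hσV' hx)).2 hx, mul_one]
  rw [h1, ← map_sum_smul f' σ a y, hae, ← hbe, h2, map_sum_smul]
  exact sum_mul_le_sum (fun x hx => (hb x hx).le) fun x hx => hf1 x (hσV' hx)

/-- The faces meeting `B` are partitioned by the intervals of a sweep in a direction close
to `v`. -/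
lemma isPartitioning (h : IsPolarCayley y A B v) (hu : IsSweepDirection y A B v u) :
    IsPartitioning (facesMeeting y A B)
      {σ ∈ facesMeeting y A B | σ.card = Module.finrank ℝ E} (restrictionSet y u)
      (Module.finrank ℝ E) where
  card_eq σ hσ := (Finset.mem_filter.1 hσ).2
  restriction_subset σ _ := restrictionSet_subset y u σ
  mem_of_between σ hσ τ hR hτ := by
    rw [Finset.mem_filter] at hσ
    have hli := h.linearIndepOn_of_mem hσ.1
    have hmeet := h.restriction_meets_right hu hσ.1 hσ.2
    have hσ' := hσ.1
    simp only [facesMeeting, Finset.mem_filter, Finset.mem_powerset] at hσ' ⊢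
    refine ⟨hτ.trans hσ'.1,
      hσ'.2.1.of_subset hli ((card_eq_finrank_of_linearIndepOn hli).2 hσ.2) hτ, ?_,
      hmeet.mono (Finset.inter_subset_inter_right hR)⟩
    rintro rfl
    have hcard := (card_eq_finrank_of_linearIndepOn (hli.mono (Finset.coe_subset.2 hτ))).1
      h.span_right
    exact hσ'.2.2.1 (Finset.eq_of_subset_of_card_le hτ (hσ.2.trans hcard.symm).le).symm
  exists_between τ hτ := by
    obtain ⟨σ, hσ, hcard, h1, h2⟩ := h.exists_between hu hτ
    exact ⟨σ, Finset.mem_filter.2 ⟨hσ, hcard⟩, h1, h2⟩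
  unique_between τ _ σ hσ σ' hσ' h1 h2 h3 h4 := by
    rw [Finset.mem_filter] at hσ hσ'
    exact h.eq_of_between hu hσ.1 hσ.2 h1 h2 hσ'.1 hσ'.2 h3 h4

/-- The `h`-numbers of the link of `v` are at most those of the faces meeting `B`. -/
lemma hTransform_link_le (h : IsPolarCayley y A B v) {d k : ℕ}
    (hd : Module.finrank ℝ E = d + 1) (hk : k ≤ d) :
    hTransform d k (fun i =>
        (({τ ∈ facesMeeting y A B | v ∈ τ ∧ τ.card = i + 1} : Finset (Finset X)).card : ℤ)) ≤
      hTransform (d + 1) k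
        (fun i => (({τ ∈ facesMeeting y A B | τ.card = i} : Finset (Finset X)).card : ℤ)) := by
  obtain ⟨u, hu⟩ := h.exists_isSweepDirection
  refine (hd ▸ h.isPartitioning hu).hTransform_link_le (fun σ hσ hv hvR => ?_) hk
  rw [Finset.mem_filter] at hσ
  have hli := h.linearIndepOn_of_mem hσ.1
  have hspan := (card_eq_finrank_of_linearIndepOn hli).2 (hσ.2.trans hd.symm)
  obtain ⟨c, hc, -, hR⟩ := h.exists_coeff hu hσ.1 (hσ.2.trans hd.symm)
  have hσV : σ ⊆ A ∪ B := subset_of_mem_facesMeeting hσ.1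
  exact absurd ((hR v hv).1 hvR) (not_lt.2 (hu.coeff_pos σ hσV hli hspan hv c hc).le)

end IsPolarCayley

end PolarCayley

section CayleyPair

variable {E : Type*} [NormedAddCommGroup E] [NormedSpace ℝ E]

/-- `τ` is the set of points of `V` on a supporting hyperplane of `V`, and is not all of `V`. -/
def IsVertexFace (V τ : Finset E) : Prop :=
  τ ⊆ V ∧ τ ≠ V ∧ ∃ (l : E →ₗ[ℝ] ℝ) (c : ℝ), (∀ x ∈ V, l x ≤ c) ∧ ∀ x ∈ V, l x = c ↔ x ∈ τ

lemma span_sub_eq_top {A : Finset E} {ℓ : E →ₗ[ℝ] ℝ} {a : ℝ} {o : E}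
    (hA : ∀ x ∈ A, ℓ x = a) (hne : A.Nonempty) (ho : ℓ o ≠ a)
    (hconst : ∀ (f : E →ₗ[ℝ] ℝ) (c : ℝ), (∀ x ∈ A, f x = c) → ∃ t : ℝ, f = t • ℓ) :
    Submodule.span ℝ ((fun x => x - o) '' (A : Set E)) = ⊤ := by
  by_contra hcon
  obtain ⟨f, hf0, hf⟩ := Submodule.exists_le_ker_of_lt_top _ (lt_top_iff_ne_top.2 hcon)
  have hfo : ∀ x ∈ A, f x = f o := by
    intro x hx
    have : f (x - o) = 0 := hf (Submodule.subset_span ⟨x, hx, rfl⟩)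
    rwa [map_sub, sub_eq_zero] at this
  obtain ⟨t, rfl⟩ := hconst f _ hfo
  obtain ⟨x, hx⟩ := hne
  have := hfo x hx
  simp only [LinearMap.smul_apply, smul_eq_mul, hA x hx] at this
  rcases mul_eq_mul_left_iff.1 this with h | h
  · exact ho h.symm
  · simp [h] at hf0

variable [DecidableEq E]

lemma isVertexFace_union_left {A B : Finset E} {ℓ : E →ₗ[ℝ] ℝ} {a b : ℝ} (hab : a ≠ b)
    (hA : ∀ x ∈ A, ℓ x = a) (hB : ∀ x ∈ B, ℓ x = b) (hne : B.Nonempty) :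
    IsVertexFace (A ∪ B) A := by
  have hdisj : ∀ x ∈ A, x ∉ B := fun x h1 h2 => hab ((hA x h1).symm.trans (hB x h2))
  refine ⟨Finset.subset_union_left, fun heq => ?_, (a - b) • ℓ, (a - b) * a, fun x hx => ?_,
    fun x hx => ?_⟩
  · obtain ⟨z, hz⟩ := hne
    exact hdisj z (heq ▸ Finset.mem_union_right _ hz) hz
  · rcases Finset.mem_union.1 hx with hx | hx
    · simp [hA x hx]
    · simp only [LinearMap.smul_apply, smul_eq_mul, hB x hx]
      nlinarith [sq_nonneg (a - b)]
  · rw [LinearMap.smul_apply, smul_eq_mul, mul_right_inj' (sub_ne_zero.2 hab)]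
    refine ⟨fun hxa => (Finset.mem_union.1 hx).resolve_right fun hxB => ?_, hA x⟩
    exact hab (hxa.symm.trans (hB x hxB))

/-- The vertex sets `A` and `B` of two full-dimensional polytopes in the parallel hyperplanes
`ℓ = a` and `ℓ = b`, such that the faces of their convex hull other than `A` and `B` are
simplices. -/
structure IsCayleyPair (A B : Finset E) (ℓ : E →ₗ[ℝ] ℝ) (a b : ℝ) : Prop where
  ne : a ≠ b
  left : ∀ x ∈ A, ℓ x = a
  right : ∀ x ∈ B, ℓ x = b
  nonempty_left : A.Nonempty
  nonempty_right : B.Nonempty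
  const_left : ∀ (f : E →ₗ[ℝ] ℝ) (c : ℝ), (∀ x ∈ A, f x = c) → ∃ t : ℝ, f = t • ℓ
  const_right : ∀ (f : E →ₗ[ℝ] ℝ) (c : ℝ), (∀ x ∈ B, f x = c) → ∃ t : ℝ, f = t • ℓ
  affineIndependent : ∀ τ, IsVertexFace (A ∪ B) τ → τ ≠ A → τ ≠ B →
    ∀ w : E → ℝ, ∑ x ∈ τ, w x = 0 → ∑ x ∈ τ, w x • x = 0 → ∀ x ∈ τ, w x = 0

namespace IsCayleyPair

variable {A B : Finset E} {ℓ : E →ₗ[ℝ] ℝ} {a b : ℝ}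

lemma symm (h : IsCayleyPair A B ℓ a b) : IsCayleyPair B A ℓ b a where
  ne := h.ne.symm
  left := h.right
  right := h.left
  nonempty_left := h.nonempty_right
  nonempty_right := h.nonempty_left
  const_left := h.const_right
  const_right := h.const_left
  affineIndependent τ hτ h1 h2 := h.affineIndependent τ (by rwa [Finset.union_comm]) h2 h1

lemma disjoint (h : IsCayleyPair A B ℓ a b) : Disjoint A B :=
  Finset.disjoint_left.2 fun x hA hB => h.ne ((h.left x hA).symm.trans (h.right x hB))

/-- The midpoint of `v` and the centroid of `B`. -/
def center (B : Finset E) (v : E) : E :=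
  (2⁻¹ : ℝ) • (v + ∑ x ∈ B, (B.card : ℝ)⁻¹ • x)

lemma map_center (h : IsCayleyPair A B ℓ a b) {v : E} (hv : v ∈ A) :
    ℓ (center B v) = (a + b) / 2 := by
  have hB : (B.card : ℝ) ≠ 0 := by exact_mod_cast h.nonempty_right.card_pos.ne'
  have : ∑ x ∈ B, ℓ x = B.card * b := by
    rw [Finset.sum_congr rfl h.right]
    simp
  simp only [center, map_smul, map_add, map_sum, smul_eq_mul, ← Finset.mul_sum, this, h.left v hv]
  field_simp

lemma balanced_center (h : IsCayleyPair A B ℓ a b) (v : E) :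
    (v - center B v) + ∑ x ∈ B, (B.card : ℝ)⁻¹ • (x - center B v) = 0 := by
  have hB : (B.card : ℝ) ≠ 0 := by exact_mod_cast h.nonempty_right.card_pos.ne'
  have hsum : ∑ x ∈ B, (B.card : ℝ)⁻¹ • (x - center B v) =
      ∑ x ∈ B, (B.card : ℝ)⁻¹ • x - center B v := by
    simp only [smul_sub, Finset.sum_sub_distrib, Finset.sum_const, ← Nat.cast_smul_eq_nsmul ℝ,
      smul_smul, mul_inv_cancel₀ hB, one_smul]
  have h2 : center B v + center B v = v + ∑ x ∈ B, (B.card : ℝ)⁻¹ • x := by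
    rw [← two_smul ℝ, center, smul_smul]
    norm_num
  rw [hsum, sub_add_sub_comm, h2, sub_self]

lemma isPolarFace_iff (h : IsCayleyPair A B ℓ a b) {v : E} (hv : v ∈ A) (τ : Finset E) :
    IsPolarFace (fun x => x - center B v) (A ∪ B) τ ↔ IsVertexFace (A ∪ B) τ := by
  have hbal := h.balanced_center v
  set o := center B v with ho
  have hB : (0 : ℝ) < B.card := by exact_mod_cast h.nonempty_right.card_pos
  have hvV : v ∈ A ∪ B := Finset.mem_union_left _ hv
  have hBV : ∀ x ∈ B, x ∈ A ∪ B := fun x hx => Finset.mem_union_right _ hx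
  have hmap : ∀ f : E →ₗ[ℝ] ℝ, f (v - o) + ∑ x ∈ B, (B.card : ℝ)⁻¹ * f (x - o) = 0 := by
    intro f
    simpa only [map_add, map_sum, map_smul, smul_eq_mul, map_zero] using congrArg f hbal
  constructor
  · rintro ⟨hτ, f, hf1, hf⟩
    refine ⟨hτ, ?_, f, 1 + f o, fun x hx => ?_, fun x hx => ?_⟩
    · rintro rfl
      have := hmap f
      rw [(hf v hvV).2 hvV, Finset.sum_congr rfl fun x hx => by rw [(hf x (hBV x hx)).2 (hBV x hx)]]
        at this
      simp only [mul_one, Finset.sum_const, nsmul_eq_mul, mul_inv_cancel₀ hB.ne'] at this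
      norm_num at this
    · have := hf1 x hx
      rw [map_sub] at this
      linarith
    · rw [← hf x hx, map_sub, sub_eq_iff_eq_add]
  · rintro ⟨hτ, hne, l, c, hl, hlc⟩
    have hle : ∀ x ∈ A ∪ B, l (x - o) ≤ c - l o := fun x hx => by
      rw [map_sub]
      linarith [hl x hx]
    have hB1 : ∑ x ∈ B, (B.card : ℝ)⁻¹ * (c - l o) = c - l o := by
      rw [Finset.sum_const, nsmul_eq_mul, mul_inv_cancel_left₀ hB.ne']
    have hB2 : ∑ x ∈ B, (B.card : ℝ)⁻¹ * l (x - o) ≤ c - l o := by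
      rw [← hB1]
      exact Finset.sum_le_sum fun x hx =>
        mul_le_mul_of_nonneg_left (hle x (hBV x hx)) (by positivity)
    have hv1 := hle v hvV
    have hnonneg : 0 ≤ c - l o := by linarith [hmap l]
    have hpos : 0 < c - l o := by
      refine hnonneg.lt_of_ne fun h0 => hne (hτ.antisymm ?_)
      rw [← h0] at hle
      have hzero : ∀ x ∈ B, l x = l o := by
        intro x hx
        have hs : ∑ x ∈ B, (B.card : ℝ)⁻¹ * l (x - o) = 0 :=
          le_antisymm (by linarith) (by linarith [hmap l])
        have hx0 := (Finset.sum_eq_zero_iff_of_nonpos fun x hx =>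
          mul_nonpos_of_nonneg_of_nonpos (by positivity) (hle x (hBV x hx))).1 hs x hx
        rcases mul_eq_zero.1 hx0 with h1 | h1
        · exact absurd h1 (by positivity)
        · rwa [map_sub, sub_eq_zero] at h1
      obtain ⟨t, rfl⟩ := h.const_right l _ hzero
      obtain ⟨z, hz⟩ := h.nonempty_right
      have hz' := hzero z hz
      simp only [LinearMap.smul_apply, smul_eq_mul, h.right z hz, ho, h.map_center hv] at hz'
      have ht : t = 0 := by
        have : t * (b - a) = 0 := by linarith
        exact (mul_eq_zero.1 this).resolve_right (sub_ne_zero.2 h.ne.symm)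
      intro x hx
      rw [← hlc x hx, ← sub_eq_zero]
      simpa [ht, eq_comm] using h0
    refine ⟨hτ, (c - l o)⁻¹ • l, fun x hx => ?_, fun x hx => ?_⟩
    · rw [LinearMap.smul_apply, smul_eq_mul, inv_mul_le_one₀ hpos]
      exact hle x hx
    · rw [LinearMap.smul_apply, smul_eq_mul, inv_mul_eq_one₀ hpos.ne', map_sub, ← hlc x hx,
        sub_left_inj, eq_comm]

lemma isVertexFace_left (h : IsCayleyPair A B ℓ a b) : IsVertexFace (A ∪ B) A :=
  isVertexFace_union_left h.ne h.left h.right h.nonempty_right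

lemma isVertexFace_right (h : IsCayleyPair A B ℓ a b) : IsVertexFace (A ∪ B) B := by
  rw [Finset.union_comm]
  exact h.symm.isVertexFace_left

lemma isPolarCayley (h : IsCayleyPair A B ℓ a b) {v : E} (hv : v ∈ A) :
    IsPolarCayley (fun x => x - center B v) A B v := by
  have hlo := h.map_center hv
  refine
    { injective := sub_left_injective
      disjoint := h.disjoint
      isPolarFace_left := (h.isPolarFace_iff hv A).2 h.isVertexFace_left
      isPolarFace_right := (h.isPolarFace_iff hv B).2 h.isVertexFace_right
      mem_left := hv
      span_left := span_sub_eq_top h.left h.nonempty_left (fun heq => h.ne ?_) h.const_left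
      span_right := span_sub_eq_top h.right h.nonempty_right (fun heq => h.ne ?_) h.const_right
      balanced := ⟨(B.card : ℝ)⁻¹, ?_, h.balanced_center v⟩
      linearIndepOn := fun σ hσ hA hB => linearIndepOn_finset_iff.2 fun w hw => ?_ }
  · linarith
  · linarith
  · have := h.nonempty_right.card_pos
    positivity
  · obtain ⟨hσV, f, -, hf⟩ := id hσ
    have hw0 : ∑ x ∈ σ, w x = 0 := by
      have := congrArg f hw
      rw [map_sum_smul, map_zero,
        Finset.sum_congr rfl fun x hx => by rw [(hf x (hσV hx)).2 hx, mul_one]] at this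
      exact this
    refine h.affineIndependent σ ((h.isPolarFace_iff hv σ).1 hσ) hA hB w hw0 ?_
    simpa [smul_sub, ← Finset.sum_smul, hw0] using hw

open Classical in
/-- The faces with vertices in both `A` and `B`. -/
def mixedFaces (A B : Finset E) : Finset (Finset E) :=
  {τ ∈ (A ∪ B).powerset | IsVertexFace (A ∪ B) τ ∧ (τ ∩ A).Nonempty ∧ (τ ∩ B).Nonempty}

open Classical in
/-- The nonempty faces properly contained in `B`. -/
def boundaryFaces (A B : Finset E) : Finset (Finset E) :=
  {τ ∈ (A ∪ B).powerset | IsVertexFace (A ∪ B) τ ∧ τ ⊆ B ∧ τ ≠ B ∧ τ.Nonempty}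

lemma mem_mixedFaces {τ : Finset E} : τ ∈ mixedFaces A B ↔
    IsVertexFace (A ∪ B) τ ∧ (τ ∩ A).Nonempty ∧ (τ ∩ B).Nonempty := by
  simp only [mixedFaces, Finset.mem_filter, Finset.mem_powerset, and_iff_right_iff_imp]
  exact fun h => h.1.1

lemma mem_boundaryFaces {τ : Finset E} : τ ∈ boundaryFaces A B ↔
    IsVertexFace (A ∪ B) τ ∧ τ ⊆ B ∧ τ ≠ B ∧ τ.Nonempty := by
  simp only [boundaryFaces, Finset.mem_filter, Finset.mem_powerset, and_iff_right_iff_imp]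
  exact fun h => h.1.1

lemma mixedFaces_comm : mixedFaces A B = mixedFaces B A := by
  ext τ
  rw [mem_mixedFaces, mem_mixedFaces, Finset.union_comm, and_comm (a := (τ ∩ A).Nonempty)]

lemma facesMeeting_eq (h : IsCayleyPair A B ℓ a b) {v : E} (hv : v ∈ A) :
    facesMeeting (fun x => x - center B v) A B = mixedFaces A B ∪ boundaryFaces A B := by
  ext τ
  rw [Finset.mem_union, mem_mixedFaces, mem_boundaryFaces]
  simp only [facesMeeting, Finset.mem_filter, Finset.mem_powerset, h.isPolarFace_iff hv]
  constructor
  · rintro ⟨hτ, hf, hne, hmeet⟩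
    by_cases hA : (τ ∩ A).Nonempty
    · exact Or.inl ⟨hf, hA, hmeet⟩
    · refine Or.inr ⟨hf, fun x hx => ?_, hne, hmeet.mono Finset.inter_subset_left⟩
      exact (Finset.mem_union.1 (hτ hx)).resolve_left fun hxA =>
        hA ⟨x, Finset.mem_inter.2 ⟨hx, hxA⟩⟩
  · rintro (⟨hf, ⟨x, hx⟩, hB⟩ | ⟨hf, hsub, hne, hnon⟩)
    · refine ⟨hf.1, hf, ?_, hB⟩
      rintro rfl
      rw [Finset.mem_inter] at hx
      exact Finset.disjoint_right.1 h.disjoint hx.1 hx.2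
    · exact ⟨hf.1, hf, hne, by rwa [Finset.inter_eq_left.2 hsub]⟩

lemma disjoint_mixedFaces_boundaryFaces (h : IsCayleyPair A B ℓ a b) :
    Disjoint (mixedFaces A B) (boundaryFaces A B) := by
  refine Finset.disjoint_left.2 fun τ h1 h2 => ?_
  rw [mem_mixedFaces] at h1
  rw [mem_boundaryFaces] at h2
  obtain ⟨x, hx⟩ := h1.2.1
  rw [Finset.mem_inter] at hx
  exact Finset.disjoint_left.1 h.disjoint hx.2 (h2.2.1 hx.1)

lemma sum_card_mixedFaces_mem (n : ℕ) :
    ∑ v ∈ A ∪ B, (({τ ∈ mixedFaces A B | v ∈ τ ∧ τ.card = n} : Finset (Finset E)).card : ℤ) =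
      n * (({τ ∈ mixedFaces A B | τ.card = n} : Finset (Finset E)).card : ℤ) := by
  have h1 := Finset.sum_card_bipartiteAbove_eq_sum_card_bipartiteBelow (s := A ∪ B)
    (t := {τ ∈ mixedFaces A B | τ.card = n}) (fun (v : E) (τ : Finset E) => v ∈ τ)
  simp only [Finset.bipartiteAbove, Finset.bipartiteBelow, Finset.filter_filter] at h1
  have h2 : ∀ τ ∈ ({τ ∈ mixedFaces A B | τ.card = n} : Finset (Finset E)),
      ({v ∈ A ∪ B | v ∈ τ} : Finset E).card = n := by
    intro τ hτ
    rw [Finset.mem_filter, mem_mixedFaces] at hτ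
    rw [Finset.filter_mem_eq_inter, Finset.inter_eq_right.2 hτ.1.1.1, hτ.2]
  rw [Finset.sum_congr rfl h2, Finset.sum_const, smul_eq_mul, mul_comm] at h1
  rw [← Nat.cast_mul, ← h1, Nat.cast_sum]
  simp only [and_comm]

variable [FiniteDimensional ℝ E] {d k : ℕ}

lemma hTransform_link_le (h : IsCayleyPair A B ℓ a b) (hd : Module.finrank ℝ E = d + 1)
    (hk : k ≤ d) {v : E} (hv : v ∈ A) :
    hTransform d k (fun i =>
        (({τ ∈ mixedFaces A B | v ∈ τ ∧ τ.card = i + 1} : Finset (Finset E)).card : ℤ)) ≤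
      hTransform (d + 1) k (fun i =>
        (({τ ∈ mixedFaces A B | τ.card = i} : Finset (Finset E)).card : ℤ) +
          (({τ ∈ boundaryFaces A B | τ.card = i} : Finset (Finset E)).card : ℤ)) := by
  have hmain := (h.isPolarCayley hv).hTransform_link_le hd hk
  rw [h.facesMeeting_eq hv] at hmain
  convert hmain using 3 with i i
  · rw [Finset.filter_union, Finset.filter_eq_empty_iff (s := boundaryFaces A B) |>.2,
      Finset.union_empty]
    rintro τ hτ ⟨hvτ, -⟩
    exact Finset.disjoint_left.1 h.disjoint hv ((mem_boundaryFaces.1 hτ).2.1 hvτ)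
  · rw [Finset.filter_union, Finset.card_union_of_disjoint
      (Finset.disjoint_filter_filter h.disjoint_mixedFaces_boundaryFaces), Nat.cast_add]

/-- The recurrence for the `h`-numbers of the faces with vertices in both `A` and `B`. -/
theorem hTransform_recurrence (h : IsCayleyPair A B ℓ a b)
    (hd : Module.finrank ℝ E = d + 1) (hk : k ≤ d) {f gA gB : ℕ → ℤ}
    (hf : ∀ i, f (i + 1) =
      (({τ ∈ mixedFaces A B | τ.card = i + 1} : Finset (Finset E)).card : ℤ))
    (hgA : ∀ i, f i + gA i = (({τ ∈ mixedFaces A B | τ.card = i} : Finset (Finset E)).card : ℤ) +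
      (({τ ∈ boundaryFaces B A | τ.card = i} : Finset (Finset E)).card : ℤ))
    (hgB : ∀ i, f i + gB i = (({τ ∈ mixedFaces A B | τ.card = i} : Finset (Finset E)).card : ℤ) +
      (({τ ∈ boundaryFaces A B | τ.card = i} : Finset (Finset E)).card : ℤ)) :
    ((d : ℤ) + 1 - k) * hTransform (d + 1) k f + (k + 1) * hTransform (d + 1) (k + 1) f ≤
      A.card * (hTransform (d + 1) k f + hTransform (d + 1) k gB) +
        B.card * (hTransform (d + 1) k f + hTransform (d + 1) k gA) := by
  have hA : ∀ v ∈ A, hTransform d k (fun i =>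
      (({τ ∈ mixedFaces A B | v ∈ τ ∧ τ.card = i + 1} : Finset (Finset E)).card : ℤ)) ≤
        hTransform (d + 1) k f + hTransform (d + 1) k gB := by
    intro v hv
    rw [← hTransform_add, funext hgB]
    exact h.hTransform_link_le hd hk hv
  have hB : ∀ v ∈ B, hTransform d k (fun i =>
      (({τ ∈ mixedFaces A B | v ∈ τ ∧ τ.card = i + 1} : Finset (Finset E)).card : ℤ)) ≤
        hTransform (d + 1) k f + hTransform (d + 1) k gA := by
    intro v hv
    rw [← hTransform_add, funext hgA, mixedFaces_comm]
    exact h.symm.hTransform_link_le hd hk hv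
  rw [← hTransform_derivative hk, ← nsmul_eq_mul, ← nsmul_eq_mul]
  refine le_trans (le_of_eq ?_) (add_le_add (Finset.sum_le_card_nsmul A _ _ hA)
    (Finset.sum_le_card_nsmul B _ _ hB))
  rw [← Finset.sum_union h.disjoint, ← hTransform_sum]
  refine hTransform_congr fun i _ => ?_
  rw [sum_card_mixedFaces_mem, hf]
  push_cast
  rfl

end IsCayleyPair

end CayleyPair

section Polytopes

variable {d : ℕ}

lemma le_of_mem_convexHull {V : Finset (Euc d)} {l : Euc d →ₗ[ℝ] ℝ} {c : ℝ}
    (hl : ∀ x ∈ V, l x ≤ c) {x : Euc d} (hx : x ∈ convexHull ℝ (V : Set (Euc d))) : l x ≤ c :=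
  convexHull_min (fun x hx => hl x hx) (convex_halfSpace_le l.isLinear c) hx

lemma mem_convexHull_iff_of_le {V τ : Finset (Euc d)} {l : Euc d →ₗ[ℝ] ℝ} {c : ℝ} (hτ : τ ⊆ V)
    (hl : ∀ x ∈ V, l x ≤ c) (hlτ : ∀ x ∈ V, l x = c ↔ x ∈ τ) {x : Euc d} :
    x ∈ convexHull ℝ (τ : Set (Euc d)) ↔ x ∈ convexHull ℝ (V : Set (Euc d)) ∧ l x = c := by
  constructor
  · exact fun hx => ⟨convexHull_mono (Finset.coe_subset.2 hτ) hx,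
      convexHull_min (fun x hx => (hlτ x (hτ hx)).2 hx) (convex_hyperplane l.isLinear c) hx⟩
  · rintro ⟨hx, hxc⟩
    rw [Finset.mem_convexHull'] at hx ⊢
    obtain ⟨w, hw0, hw1, rfl⟩ := hx
    have hzero : ∀ y ∈ V, y ∉ τ → w y = 0 := by
      intro y hy hyτ
      by_contra hne
      have := eq_one_of_sum_le_sum_mul (s := V) (a := w) (g := fun z => l z - c + 1) hw0
        (fun z hz => by linarith [hl z hz]) ?_ hy ((hw0 y hy).lt_of_ne' hne)
      · exact hyτ ((hlτ y hy).1 (by linarith))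
      · rw [map_sum] at hxc
        simp only [map_smul, smul_eq_mul] at hxc
        simp only [mul_add, mul_sub, Finset.sum_add_distrib, Finset.sum_sub_distrib, hxc,
          ← Finset.sum_mul, hw1]
        simp
    refine ⟨w, fun y hy => hw0 y (hτ hy), ?_, ?_⟩
    · rw [← hw1]
      exact Finset.sum_subset hτ hzero
    · exact Finset.sum_subset hτ fun y hy hyτ => by rw [hzero y hy hyτ, zero_smul]

namespace IsVertexFace

variable {V τ : Finset (Euc d)}

lemma isExposed (h : IsVertexFace V τ) :
    IsExposed ℝ (convexHull ℝ (V : Set (Euc d))) (convexHull ℝ (τ : Set (Euc d))) := by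
  obtain ⟨hτ, -, l, c, hl, hlτ⟩ := h
  rintro ⟨z, hz⟩
  refine ⟨l.toContinuousLinearMap, ?_⟩
  ext x
  rw [mem_convexHull_iff_of_le hτ hl hlτ] at hz
  simp only [mem_convexHull_iff_of_le hτ hl hlτ, mem_ofPred_eq, and_congr_right_iff,
    LinearMap.coe_toContinuousLinearMap']
  intro hx
  constructor
  · rintro rfl y hy
    exact le_of_mem_convexHull hl hy
  · exact fun hmax => (le_of_mem_convexHull hl hx).antisymm (hz.2 ▸ hmax z hz.1)

lemma mem_convexHull_iff (h : IsVertexFace V τ) {x : Euc d} (hx : x ∈ V) :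
    x ∈ convexHull ℝ (τ : Set (Euc d)) ↔ x ∈ τ := by
  obtain ⟨hτ, -, l, c, hl, hlτ⟩ := h
  rw [mem_convexHull_iff_of_le hτ hl hlτ, ← hlτ x hx]
  exact and_iff_right (subset_convexHull ℝ _ hx)

lemma vertSet_convexHull (h : IsVertexFace V τ)
    (hV : vertSet (convexHull ℝ (V : Set (Euc d))) = V) :
    vertSet (convexHull ℝ (τ : Set (Euc d))) = τ := by
  rw [vertSet, h.isExposed.isExtreme.extremePoints_eq, ← vertSet, hV]
  ext x
  refine ⟨fun hx => (h.mem_convexHull_iff hx.2).1 hx.1, fun hx => ?_⟩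
  exact ⟨subset_convexHull ℝ _ hx, h.1 hx⟩

lemma isProperFaceOf (h : IsVertexFace V τ) (hne : τ.Nonempty)
    (hV : vertSet (convexHull ℝ (V : Set (Euc d))) = V) :
    IsProperFaceOf (convexHull ℝ (V : Set (Euc d))) (convexHull ℝ (τ : Set (Euc d))) := by
  refine ⟨h.isExposed, fun heq => h.2.1 ?_, convexHull_nonempty_iff.2 hne⟩
  rw [← Finset.coe_inj, ← h.vertSet_convexHull hV, heq, hV]

end IsVertexFace

lemma IsProperFaceOf.exists_isVertexFace {V : Finset (Euc d)} {G : Set (Euc d)}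
    (h : IsProperFaceOf (convexHull ℝ (V : Set (Euc d))) G) :
    ∃ τ, IsVertexFace V τ ∧ τ.Nonempty ∧ convexHull ℝ (τ : Set (Euc d)) = G := by
  classical
  obtain ⟨hexp, hne, hnon⟩ := h
  obtain ⟨l, hl⟩ := hexp hnon
  obtain ⟨z, hz⟩ := hnon
  have hz' := hz
  rw [hl] at hz'
  have hle : ∀ x ∈ V, (l : Euc d →ₗ[ℝ] ℝ) x ≤ l z := fun x hx =>
    hz'.2 x (subset_convexHull ℝ _ hx)
  have hτ : ∀ x ∈ V, (l : Euc d →ₗ[ℝ] ℝ) x = l z ↔ x ∈ ({x ∈ V | l x = l z} : Finset (Euc d)) := by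
    intro x hx
    simp [hx]
  have heq : convexHull ℝ (({x ∈ V | l x = l z} : Finset (Euc d)) : Set (Euc d)) = G := by
    ext x
    rw [mem_convexHull_iff_of_le (Finset.filter_subset _ _) hle hτ, hl]
    refine and_congr_right fun hx => ⟨fun hxz y hy => ?_, fun hmax => ?_⟩
    · exact (hz'.2 y hy).trans hxz.ge
    · exact (hz'.2 x hx).antisymm (hmax z hz'.1)
  refine ⟨_, ⟨Finset.filter_subset _ _, fun h => hne ?_, l, l z, hle, hτ⟩, ?_, heq⟩
  · rw [← heq, h]
  · rw [← Finset.coe_nonempty, ← convexHull_nonempty_iff (𝕜 := ℝ), heq]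
    exact ⟨z, hz⟩

lemma ncard_properFaces_eq {V : Finset (Euc d)}
    (hV : vertSet (convexHull ℝ (V : Set (Euc d))) = V) {𝒢 : Set (Set (Euc d))}
    {𝒮 : Finset (Finset (Euc d))}
    (h𝒢 : ∀ G ∈ 𝒢, IsProperFaceOf (convexHull ℝ (V : Set (Euc d))) G)
    (h𝒮 : ∀ τ ∈ 𝒮, IsVertexFace V τ)
    (h : ∀ τ, IsVertexFace V τ → τ.Nonempty → (convexHull ℝ (τ : Set (Euc d)) ∈ 𝒢 ↔ τ ∈ 𝒮))
    (hne : ∅ ∉ 𝒮) : 𝒢.ncard = 𝒮.card := by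
  have heq : 𝒢 = (fun τ : Finset (Euc d) => convexHull ℝ (τ : Set (Euc d))) '' (𝒮 : Set _) := by
    ext G
    constructor
    · intro hG
      obtain ⟨τ, hτ, hτne, rfl⟩ := (h𝒢 G hG).exists_isVertexFace
      exact ⟨τ, (h τ hτ hτne).1 hG, rfl⟩
    · rintro ⟨τ, hτ, rfl⟩
      refine (h τ (h𝒮 τ hτ) (Finset.nonempty_iff_ne_empty.2 fun h0 => hne ?_)).2 hτ
      exact h0 ▸ hτ
  rw [heq, Set.InjOn.ncard_image, Set.ncard_coe_finset]
  intro τ hτ τ' hτ' hττ'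
  have := congrArg vertSet hττ'
  dsimp only at this
  rw [(h𝒮 τ hτ).vertSet_convexHull hV, (h𝒮 τ' hτ').vertSet_convexHull hV] at this
  exact Finset.coe_inj.1 this

lemma IsSimplexSet.affineIndependent {τ : Finset (Euc d)}
    (h : IsSimplexSet (convexHull ℝ (τ : Set (Euc d))))
    (hτ : vertSet (convexHull ℝ (τ : Set (Euc d))) = τ) :
    AffineIndependent ℝ (fun v : {x // x ∈ τ} => (v : Euc d)) := by
  obtain ⟨S, hS, heq⟩ := h
  have hsub : (τ : Set (Euc d)) ⊆ S := by
    rw [← hτ, heq]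
    exact extremePoints_convexHull_subset
  exact hS.mono hsub

lemma IsSimplexSet.setDim_add_one {τ : Finset (Euc d)}
    (h : IsSimplexSet (convexHull ℝ (τ : Set (Euc d))))
    (hτ : vertSet (convexHull ℝ (τ : Set (Euc d))) = τ) (hne : τ.Nonempty) :
    setDim (convexHull ℝ (τ : Set (Euc d))) + 1 = τ.card := by
  have hcard : Fintype.card {x // x ∈ τ} = (τ.card - 1) + 1 := by
    have := hne.card_pos
    rw [Fintype.card_coe]
    omega
  have := (h.affineIndependent hτ).finrank_vectorSpan hcard
  rw [Subtype.range_coe_subtype] at this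
  rw [setDim, affineSpan_convexHull, direction_affineSpan]
  have h1 := hne.card_pos
  have h2 : {x | x ∈ τ} = (τ : Set (Euc d)) := rfl
  rw [h2] at this
  omega

lemma IsPolytope.exists_vertSet {P : Set (Euc d)} (h : IsPolytope P) :
    ∃ V : Finset (Euc d), vertSet P = V ∧ P = convexHull ℝ (V : Set (Euc d)) := by
  obtain ⟨S, hS, rfl⟩ := h
  have hfin : (vertSet (convexHull ℝ S)).Finite := hS.subset extremePoints_convexHull_subset
  refine ⟨hfin.toFinset, by simp, ?_⟩
  rw [hfin.coe_toFinset, ← (hfin.isClosed_convexHull ℝ).closure_eq]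
  exact (closure_convexHull_extremePoints (hS.isCompact_convexHull ℝ) (convex_convexHull ℝ S)).symm

open Classical in
/-- The vertex sets of the proper faces of the convex hull of `V`. -/
def vertexFaces (V : Finset (Euc d)) : Finset (Finset (Euc d)) :=
  {τ ∈ V.powerset | IsVertexFace V τ ∧ τ.Nonempty}

lemma mem_vertexFaces {V τ : Finset (Euc d)} :
    τ ∈ vertexFaces V ↔ IsVertexFace V τ ∧ τ.Nonempty := by
  simp only [vertexFaces, Finset.mem_filter, Finset.mem_powerset, and_iff_right_iff_imp]
  exact fun h => h.1.1

lemma IsSimplicialPolytope.faceCount_eq {V : Finset (Euc d)}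
    (h : IsSimplicialPolytope (convexHull ℝ (V : Set (Euc d))))
    (hV : vertSet (convexHull ℝ (V : Set (Euc d))) = V) (k : ℕ) :
    faceCount (convexHull ℝ (V : Set (Euc d))) k =
      ({τ ∈ vertexFaces V | τ.card = k + 1} : Finset (Finset (Euc d))).card := by
  refine ncard_properFaces_eq hV (fun G hG => hG.1) (fun τ hτ => ?_) (fun τ hτ hne => ?_) ?_
  · exact (mem_vertexFaces.1 (Finset.mem_filter.1 hτ).1).1
  · have hface := hτ.isProperFaceOf hne hV
    have := (h.2 _ hface).setDim_add_one (hτ.vertSet_convexHull hV) hne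
    simp only [mem_ofPred_eq, hface, true_and, Finset.mem_filter, mem_vertexFaces, hτ, hne]
    omega
  · simp

end Polytopes

section CayleyPolytope

variable {d : ℕ}

/-- The height function `x ↦ x_{d+1}`. -/
def height (d : ℕ) : Euc (d + 1) →ₗ[ℝ] ℝ := LinearMap.proj (Fin.last d)

/-- The linear embedding `x ↦ (x, 0)`. -/
def liftLinear (d : ℕ) : Euc d →ₗ[ℝ] Euc (d + 1) where
  toFun := lift 0
  map_add' x y := by
    ext i
    refine Fin.lastCases ?_ (fun i => ?_) i <;> simp [lift]
  map_smul' t x := by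
    ext i
    refine Fin.lastCases ?_ (fun i => ?_) i <;> simp [lift]

/-- The projection forgetting the last coordinate. -/
def dropLast (d : ℕ) : Euc (d + 1) →ₗ[ℝ] Euc d := LinearMap.funLeft ℝ ℝ Fin.castSucc

@[simp] lemma height_lift (t : ℝ) (x : Euc d) : height d (lift t x) = t := by
  simp [height, lift]

@[simp] lemma dropLast_lift (t : ℝ) (x : Euc d) : dropLast d (lift t x) = x := by
  ext i
  simp [dropLast, lift, LinearMap.funLeft_apply]

lemma lift_eq_add (t : ℝ) (x : Euc d) : lift t x = liftLinear d x + t • lift 1 0 := by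
  ext i
  refine Fin.lastCases ?_ (fun i => ?_) i <;> simp [lift, liftLinear]

lemma lift_height_dropLast (x : Euc (d + 1)) : lift (height d x) (dropLast d x) = x := by
  ext i
  refine Fin.lastCases ?_ (fun i => ?_) i <;> simp [lift, height, dropLast, LinearMap.funLeft_apply]

lemma lift_injective (t : ℝ) : Function.Injective (lift t : Euc d → Euc (d + 1)) :=
  Function.LeftInverse.injective (dropLast_lift t)

lemma image_lift_convexHull (t : ℝ) (S : Set (Euc d)) :
    lift t '' convexHull ℝ S = convexHull ℝ (lift t '' S) := by
  have : (lift t : Euc d → Euc (d + 1)) =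
      ⇑((liftLinear d).toAffineMap +
        AffineMap.const ℝ (Euc d) (t • (lift 1 0 : Euc (d + 1)))) := by
    ext1 x
    simp [lift_eq_add t x]
  rw [this, AffineMap.image_convexHull]

lemma vertSet_image_lift (t : ℝ) (P : Set (Euc d)) :
    lift t '' vertSet P ⊆ vertSet (lift t '' P) := by
  rintro _ ⟨x, hx, rfl⟩
  refine ⟨⟨x, hx.1, rfl⟩, ?_⟩
  rintro _ ⟨x₁, h₁, rfl⟩ _ ⟨x₂, h₂, rfl⟩ ⟨a, b, ha, hb, hab, heq⟩
  rw [hx.2 h₁ h₂ ⟨a, b, ha, hb, hab, ?_⟩]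
  simpa using congrArg (dropLast d) heq

lemma eq_smul_height_of_const {V : Finset (Euc d)}
    (hdim : setDim (convexHull ℝ (V : Set (Euc d))) = d) (t : ℝ) (f : Euc (d + 1) →ₗ[ℝ] ℝ) (c : ℝ)
    (hf : ∀ x ∈ V.image (lift t), f x = c) : ∃ s : ℝ, f = s • height d := by
  have htop : vectorSpan ℝ (V : Set (Euc d)) = ⊤ := by
    rw [setDim, affineSpan_convexHull, direction_affineSpan] at hdim
    refine Submodule.eq_top_of_finrank_eq ?_
    simp [hdim]
  have hker : vectorSpan ℝ (V : Set (Euc d)) ≤ LinearMap.ker (f ∘ₗ liftLinear d) := by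
    rw [vectorSpan_def, Submodule.span_le]
    rintro _ ⟨x, hx, y, hy, rfl⟩
    have hx' := hf _ (Finset.mem_image_of_mem _ hx)
    have hy' := hf _ (Finset.mem_image_of_mem _ hy)
    rw [lift_eq_add, map_add] at hx' hy'
    simp only [vsub_eq_sub, SetLike.mem_coe, LinearMap.mem_ker, map_sub, LinearMap.comp_apply]
    linarith
  refine ⟨f (lift 1 0), LinearMap.ext fun x => ?_⟩
  have hx : f (liftLinear d (dropLast d x)) = 0 := by
    have : dropLast d x ∈ LinearMap.ker (f ∘ₗ liftLinear d) :=
      hker (htop ▸ Submodule.mem_top)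
    exact this
  conv_lhs => rw [← lift_height_dropLast x, lift_eq_add, map_add, hx, zero_add, map_smul]
  simp [mul_comm]

lemma isVertexFace_image_lift {V τ : Finset (Euc d)} {A : Finset (Euc (d + 1))} {a b : ℝ}
    (hab : a ≠ b) (hA : ∀ x ∈ A, height d x = a) (hτ : τ ⊆ V) :
    (IsVertexFace (A ∪ V.image (lift b)) (τ.image (lift b)) ∧
      τ.image (lift b) ≠ V.image (lift b)) ↔ IsVertexFace V τ := by
  have hmem : ∀ x ∈ V, lift b x ∈ A ∪ V.image (lift b) := fun x hx =>
    Finset.mem_union_right _ (Finset.mem_image_of_mem _ hx)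
  have hinj : ∀ x, lift b x ∈ τ.image (lift b) ↔ x ∈ τ := fun x =>
    Function.Injective.mem_finset_image (lift_injective b)
  constructor
  · rintro ⟨⟨-, -, l, c, hl, hlc⟩, hne⟩
    refine ⟨hτ, fun h => hne (by rw [h]), l ∘ₗ liftLinear d, c - b * l (lift 1 0),
      fun x hx => ?_, fun x hx => ?_⟩
    · have := hl _ (hmem x hx)
      rw [lift_eq_add, map_add, map_smul, smul_eq_mul] at this
      rw [LinearMap.comp_apply]
      linarith
    · rw [← hinj, ← hlc _ (hmem x hx), lift_eq_add b x, map_add, map_smul, smul_eq_mul,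
        LinearMap.comp_apply, eq_sub_iff_add_eq]
  · rintro ⟨-, hne, l, c, hl, hlc⟩
    have hne' : τ.image (lift b) ≠ V.image (lift b) := fun h =>
      hne (Finset.image_injective (lift_injective b) h)
    have hsub : τ.image (lift b) ⊆ V.image (lift b) := Finset.image_subset_image hτ
    obtain ⟨M, hM⟩ : ∃ M : ℝ, ∀ x ∈ A, l (dropLast d x) - c < M := by
      obtain ⟨M, hM⟩ := (A.image fun x => l (dropLast d x) - c).bddAbove
      refine ⟨M + 1, fun x hx => ?_⟩
      have := hM (Finset.mem_coe.2 (Finset.mem_image_of_mem _ hx))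
      linarith
    have hba : b - a ≠ 0 := sub_ne_zero.2 hab.symm
    set L : Euc (d + 1) →ₗ[ℝ] ℝ := l ∘ₗ dropLast d + (M / (b - a)) • height d with hL
    have hLA : ∀ x ∈ A, L x < c + M / (b - a) * b := by
      intro x hx
      have h1 := hM x hx
      have h2 : M / (b - a) * b = M / (b - a) * a + M := by
        field_simp
        ring
      simp only [hL, LinearMap.add_apply, LinearMap.comp_apply, LinearMap.smul_apply, smul_eq_mul,
        hA x hx, h2]
      linarith
    have hLB : ∀ x, L (lift b x) = l x + M / (b - a) * b := by
      intro x
      simp [hL]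
    refine ⟨⟨hsub.trans Finset.subset_union_right, fun h => ?_, L, c + M / (b - a) * b,
      fun x hx => ?_, fun x hx => ?_⟩, hne'⟩
    · exact hne' (hsub.antisymm (h ▸ Finset.subset_union_right))
    · rcases Finset.mem_union.1 hx with hx | hx
      · exact (hLA x hx).le
      · obtain ⟨z, hz, rfl⟩ := Finset.mem_image.1 hx
        rw [hLB]
        linarith [hl z hz]
    · rcases Finset.mem_union.1 hx with hx | hx
      · refine iff_of_false (hLA x hx).ne fun hmem => hab ?_
        obtain ⟨z, hz, rfl⟩ := Finset.mem_image.1 hmem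
        simpa using (hA _ hx).symm
      · obtain ⟨z, hz, rfl⟩ := Finset.mem_image.1 hx
        rw [hLB, hinj, ← hlc z hz, add_left_inj]

lemma card_boundaryFaces {V : Finset (Euc d)} {A : Finset (Euc (d + 1))} {a b : ℝ}
    (hab : a ≠ b) (hA : ∀ x ∈ A, height d x = a) (n : ℕ) :
    ({τ ∈ IsCayleyPair.boundaryFaces A (V.image (lift b)) | τ.card = n} :
      Finset (Finset (Euc (d + 1)))).card =
    ({τ ∈ vertexFaces V | τ.card = n} : Finset (Finset (Euc d))).card := by
  rw [← Finset.card_image_of_injective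
    ({τ ∈ vertexFaces V | τ.card = n} : Finset (Finset (Euc d)))
    (Finset.image_injective (lift_injective b))]
  refine congrArg Finset.card (Finset.ext fun σ => ?_)
  simp only [Finset.mem_filter, Finset.mem_image, IsCayleyPair.mem_boundaryFaces, mem_vertexFaces]
  constructor
  · rintro ⟨⟨hσ, hsub, hne, hnon⟩, hcard⟩
    obtain ⟨τ, hτ, rfl⟩ := Finset.subset_image_iff.1 hsub
    refine ⟨τ, ⟨⟨(isVertexFace_image_lift hab hA (Finset.coe_subset.1 hτ)).1 ⟨hσ, hne⟩,
      Finset.image_nonempty.1 hnon⟩, ?_⟩, rfl⟩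
    rwa [Finset.card_image_of_injective _ (lift_injective b)] at hcard
  · rintro ⟨τ, ⟨⟨hτ, hnon⟩, hcard⟩, rfl⟩
    obtain ⟨h1, h2⟩ := (isVertexFace_image_lift hab hA hτ.1).2 hτ
    refine ⟨⟨h1, Finset.image_subset_image hτ.1, h2, hnon.image _⟩, ?_⟩
    rw [Finset.card_image_of_injective _ (lift_injective b), hcard]

lemma cayley_convexHull (V₁ V₂ : Finset (Euc d)) :
    cayley (convexHull ℝ (V₁ : Set (Euc d))) (convexHull ℝ (V₂ : Set (Euc d))) =
      convexHull ℝ ((V₁.image (lift 0) ∪ V₂.image (lift 1) : Finset (Euc (d + 1))) :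
        Set (Euc (d + 1))) := by
  rw [cayley, image_lift_convexHull, image_lift_convexHull, convexHull_convexHull_union_left,
    convexHull_convexHull_union_right]
  push_cast
  rfl

lemma height_image_lift (V : Finset (Euc d)) (t : ℝ) : ∀ x ∈ V.image (lift t), height d x = t := by
  intro x hx
  obtain ⟨z, -, rfl⟩ := Finset.mem_image.1 hx
  exact height_lift t z

lemma subset_vertSet_of_isVertexFace {V : Finset (Euc d)} {W : Finset (Euc (d + 1))} {t : ℝ}
    (hV : vertSet (convexHull ℝ (V : Set (Euc d))) = V) (h : IsVertexFace W (V.image (lift t))) :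
    ((V.image (lift t) : Finset (Euc (d + 1))) : Set (Euc (d + 1))) ⊆
      vertSet (convexHull ℝ (W : Set (Euc (d + 1)))) := by
  have h1 := vertSet_image_lift t (convexHull ℝ (V : Set (Euc d)))
  rw [hV, image_lift_convexHull, ← Finset.coe_image] at h1
  refine h1.trans ?_
  rw [vertSet, h.isExposed.isExtreme.extremePoints_eq]
  exact inter_subset_right

lemma vertSet_convexHull_union {V₁ V₂ : Finset (Euc d)} (hne₁ : V₁.Nonempty) (hne₂ : V₂.Nonempty)
    (hV₁ : vertSet (convexHull ℝ (V₁ : Set (Euc d))) = V₁)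
    (hV₂ : vertSet (convexHull ℝ (V₂ : Set (Euc d))) = V₂) :
    vertSet (convexHull ℝ ((V₁.image (lift 0) ∪ V₂.image (lift 1) : Finset (Euc (d + 1))) :
        Set (Euc (d + 1)))) =
      ((V₁.image (lift 0) ∪ V₂.image (lift 1) : Finset (Euc (d + 1))) : Set (Euc (d + 1))) := by
  refine extremePoints_convexHull_subset.antisymm ?_
  intro x hx
  rcases Finset.mem_union.1 (Finset.mem_coe.1 hx) with hx | hx
  · exact subset_vertSet_of_isVertexFace hV₁ (isVertexFace_union_left zero_ne_one
      (height_image_lift V₁ 0) (height_image_lift V₂ 1) (hne₂.image _)) hx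
  · refine subset_vertSet_of_isVertexFace hV₂ ?_ hx
    rw [Finset.union_comm]
    exact isVertexFace_union_left one_ne_zero
      (height_image_lift V₂ 1) (height_image_lift V₁ 0) (hne₁.image _)

lemma isCayleyPair_image_lift {V₁ V₂ : Finset (Euc d)} (hne₁ : V₁.Nonempty) (hne₂ : V₂.Nonempty)
    (hV₁ : vertSet (convexHull ℝ (V₁ : Set (Euc d))) = V₁)
    (hV₂ : vertSet (convexHull ℝ (V₂ : Set (Euc d))) = V₂)
    (hdim₁ : setDim (convexHull ℝ (V₁ : Set (Euc d))) = d)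
    (hdim₂ : setDim (convexHull ℝ (V₂ : Set (Euc d))) = d)
    (hsimplex : ∀ τ, IsVertexFace (V₁.image (lift 0) ∪ V₂.image (lift 1)) τ → τ.Nonempty →
      τ ≠ V₁.image (lift 0) → τ ≠ V₂.image (lift 1) →
      IsSimplexSet (convexHull ℝ (τ : Set (Euc (d + 1))))) :
    IsCayleyPair (V₁.image (lift 0)) (V₂.image (lift 1)) (height d) 0 1 where
  ne := zero_ne_one
  left := height_image_lift V₁ 0
  right := height_image_lift V₂ 1
  nonempty_left := hne₁.image _
  nonempty_right := hne₂.image _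
  const_left := eq_smul_height_of_const hdim₁ 0
  const_right := eq_smul_height_of_const hdim₂ 1
  affineIndependent τ hτ h1 h2 w hw0 hw x hx := by
    have haff := (hsimplex τ hτ ⟨x, hx⟩ h1 h2).affineIndependent
      (hτ.vertSet_convexHull (vertSet_convexHull_union hne₁ hne₂ hV₁ hV₂))
    refine affineIndependent_iff.1 haff Finset.univ (fun z => w z) ?_ ?_ ⟨x, hx⟩
      (Finset.mem_univ _)
    · rw [← hw0]
      exact Finset.sum_coe_sort τ w
    · rw [← hw]
      exact Finset.sum_coe_sort τ fun z => w z • z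

lemma inter_image_lift_nonempty_iff {V : Finset (Euc d)} {W τ : Finset (Euc (d + 1))} {t : ℝ}
    (hface : IsVertexFace W (V.image (lift t))) (hτ : τ ⊆ W) :
    ((τ : Set (Euc (d + 1))) ∩ lift t '' convexHull ℝ (V : Set (Euc d))).Nonempty ↔
      (τ ∩ V.image (lift t)).Nonempty := by
  rw [image_lift_convexHull, ← Finset.coe_image, ← Finset.coe_nonempty, Finset.coe_inter]
  refine iff_of_eq (congrArg Set.Nonempty (Set.ext fun x => and_congr_right fun hx => ?_))
  exact hface.mem_convexHull_iff (hτ hx)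

lemma fFm1_succ_eq {V₁ V₂ : Finset (Euc d)}
    (h : IsCayleyPair (V₁.image (lift 0)) (V₂.image (lift 1)) (height d) 0 1)
    (hV : vertSet (convexHull ℝ ((V₁.image (lift 0) ∪ V₂.image (lift 1) :
      Finset (Euc (d + 1))) : Set (Euc (d + 1)))) =
      ((V₁.image (lift 0) ∪ V₂.image (lift 1) : Finset (Euc (d + 1))) : Set (Euc (d + 1))))
    (hsimplex : ∀ τ, IsVertexFace (V₁.image (lift 0) ∪ V₂.image (lift 1)) τ → τ.Nonempty →
      τ ≠ V₁.image (lift 0) → τ ≠ V₂.image (lift 1) →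
      IsSimplexSet (convexHull ℝ (τ : Set (Euc (d + 1))))) (i : ℕ) :
    fFm1 (convexHull ℝ (V₁ : Set (Euc d))) (convexHull ℝ (V₂ : Set (Euc d))) (i + 1) =
      (({τ ∈ IsCayleyPair.mixedFaces (V₁.image (lift 0)) (V₂.image (lift 1)) | τ.card = i + 1} :
        Finset (Finset (Euc (d + 1)))).card : ℤ) := by
  rw [fFm1, Nat.cast_inj]
  refine ncard_properFaces_eq hV (fun G hG => ?_) (fun τ hτ => ?_) (fun τ hτ hne => ?_) ?_
  · rw [← cayley_convexHull]
    exact hG.1.1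
  · exact (IsCayleyPair.mem_mixedFaces.1 (Finset.mem_filter.1 hτ).1).1
  · have hface := hτ.isProperFaceOf hne hV
    have hvert := hτ.vertSet_convexHull hV
    have hdim : (τ ∩ V₁.image (lift 0)).Nonempty → (τ ∩ V₂.image (lift 1)).Nonempty →
        setDim (convexHull ℝ (τ : Set (Euc (d + 1)))) + 1 = τ.card := by
      intro h1 h2
      refine (hsimplex τ hτ hne ?_ ?_).setDim_add_one hvert hne
      · rintro rfl
        exact Finset.not_disjoint_iff_nonempty_inter.2 h2 h.disjoint
      · rintro rfl
        exact Finset.not_disjoint_iff_nonempty_inter.2 h1 h.disjoint.symm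
    simp only [mem_ofPred_eq, cayleyFaces, cayley_convexHull, hface, true_and, hvert,
      Finset.mem_filter, IsCayleyPair.mem_mixedFaces, hτ,
      inter_image_lift_nonempty_iff h.isVertexFace_left hτ.1,
      inter_image_lift_nonempty_iff h.isVertexFace_right hτ.1]
    refine and_congr_right fun ⟨h1, h2⟩ => ?_
    have := hdim h1 h2
    omega
  · simp

lemma fBdm1_add_fFm1 {V : Finset (Euc d)} {A : Finset (Euc (d + 1))}
    {a b : ℝ} (hab : a ≠ b) (hA : ∀ x ∈ A, height d x = a)
    (hV : vertSet (convexHull ℝ (V : Set (Euc d))) = V)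
    (hsimp : IsSimplicialPolytope (convexHull ℝ (V : Set (Euc d)))) {f : ℕ → ℤ}
    {M : Finset (Finset (Euc (d + 1)))} (hM : ∅ ∉ M)
    (hf : ∀ i, f (i + 1) =
      (({τ ∈ M | τ.card = i + 1} : Finset (Finset (Euc (d + 1)))).card : ℤ))
    (hf0 : f 0 = -1) (i : ℕ) :
    f i + fBdm1 (convexHull ℝ (V : Set (Euc d))) i =
      (({τ ∈ M | τ.card = i} : Finset (Finset (Euc (d + 1)))).card : ℤ) +
      (({τ ∈ IsCayleyPair.boundaryFaces A (V.image (lift b)) | τ.card = i} :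
        Finset (Finset (Euc (d + 1)))).card : ℤ) := by
  rw [card_boundaryFaces hab hA]
  cases i with
  | zero =>
    have h1 : ({τ ∈ M | τ.card = 0} : Finset (Finset (Euc (d + 1)))) = ∅ :=
      Finset.filter_eq_empty_iff.2 fun τ hτ h0 => hM (Finset.card_eq_zero.1 h0 ▸ hτ)
    have h2 : ({τ ∈ vertexFaces V | τ.card = 0} : Finset (Finset (Euc d))) = ∅ :=
      Finset.filter_eq_empty_iff.2 fun τ hτ h0 =>
        (mem_vertexFaces.1 hτ).2.ne_empty (Finset.card_eq_zero.1 h0)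
    rw [h1, h2, hf0]
    simp [fBdm1]
  | succ i => rw [hf, fBdm1, hsimp.faceCount_eq hV]

lemma gBd_eq_hTransform (P : Set (Euc d)) {k : ℕ} (hk : k ≤ d) :
    gBd P k = hTransform (d + 1) k (fBdm1 P) := by
  rw [hTransform_pascal hk, gBd, if_pos hk, if_pos (by omega : k - 1 ≤ d)]
  rfl

end CayleyPolytope

/-- the recurrence inequality for the `h`-vector of 𝓕. -/
theorem statement_10
    (d n1 n2 : ℕ) (hd : 2 ≤ d)
    (P1 P2 : Set (Euc d))
    (hP1 : IsSimplicialPolytope P1) (hP2 : IsSimplicialPolytope P2)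
    (hdim1 : setDim P1 = d) (hdim2 : setDim P2 = d)
    (hv1 : vertCount P1 = n1) (hv2 : vertCount P2 = n2)
    (hn1 : d + 1 ≤ n1) (hn2 : d + 1 ≤ n2)
    (hP : ∀ F : Set (Euc (d + 1)), IsProperFaceOf (cayley P1 P2) F →
      F ≠ lift 0 '' P1 → F ≠ lift 1 '' P2 → IsSimplexSet F) :
    ∀ k : ℕ, k ≤ d →
      (hF P1 P2 (k + 1) : ℚ) ≤
        (((n1 : ℚ) + n2 - d - 1 + k) / (k + 1)) * (hF P1 P2 k : ℚ)
          + ((n1 : ℚ) / (k + 1)) * (gBd P2 k : ℚ)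
          + ((n2 : ℚ) / (k + 1)) * (gBd P1 k : ℚ) := by
  intro k hk
  obtain ⟨V₁, hV₁, hPV₁⟩ := hP1.1.exists_vertSet
  obtain ⟨V₂, hV₂, hPV₂⟩ := hP2.1.exists_vertSet
  have hc₁ : V₁.card = n1 := by rw [← hv1, vertCount, hV₁, Set.ncard_coe_finset]
  have hc₂ : V₂.card = n2 := by rw [← hv2, vertCount, hV₂, Set.ncard_coe_finset]
  have hne₁ : V₁.Nonempty := Finset.card_pos.1 (by omega)
  have hne₂ : V₂.Nonempty := Finset.card_pos.1 (by omega)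
  subst hPV₁ hPV₂
  have hV := vertSet_convexHull_union hne₁ hne₂ hV₁ hV₂
  have hface₁ := isVertexFace_union_left zero_ne_one (height_image_lift V₁ 0)
    (height_image_lift V₂ 1) (hne₂.image _)
  have hface₂ := isVertexFace_union_left one_ne_zero (height_image_lift V₂ 1)
    (height_image_lift V₁ 0) (hne₁.image _)
  rw [Finset.union_comm] at hface₂
  rw [cayley_convexHull, image_lift_convexHull, image_lift_convexHull, ← Finset.coe_image,
    ← Finset.coe_image] at hP
  have hsimplex : ∀ τ, IsVertexFace (V₁.image (lift 0) ∪ V₂.image (lift 1)) τ → τ.Nonempty →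
      τ ≠ V₁.image (lift 0) → τ ≠ V₂.image (lift 1) →
      IsSimplexSet (convexHull ℝ (τ : Set (Euc (d + 1)))) := by
    intro τ hτ hne h1 h2
    refine hP _ (hτ.isProperFaceOf hne hV) (fun heq => h1 ?_) (fun heq => h2 ?_)
    · rw [← Finset.coe_inj, ← hτ.vertSet_convexHull hV, heq, hface₁.vertSet_convexHull hV]
    · rw [← Finset.coe_inj, ← hτ.vertSet_convexHull hV, heq, hface₂.vertSet_convexHull hV]
  have hpair := isCayleyPair_image_lift hne₁ hne₂ hV₁ hV₂ hdim1 hdim2 hsimplex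
  have hf := fFm1_succ_eq hpair hV hsimplex
  have hM : ∅ ∉ IsCayleyPair.mixedFaces (V₁.image (lift 0)) (V₂.image (lift 1)) := by
    simp [IsCayleyPair.mem_mixedFaces]
  have hmain := hpair.hTransform_recurrence (by simp) hk hf
    (fBdm1_add_fFm1 one_ne_zero (height_image_lift V₂ 1) hV₁ hP1 hM hf rfl)
    (fBdm1_add_fFm1 zero_ne_one (height_image_lift V₁ 0) hV₂ hP2 hM hf rfl)
  rw [← gBd_eq_hTransform _ hk, ← gBd_eq_hTransform _ hk,
    Finset.card_image_of_injective _ (lift_injective 0),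
    Finset.card_image_of_injective _ (lift_injective 1), hc₁, hc₂] at hmain
  change ((d : ℤ) + 1 - k) * hF _ _ k + (k + 1) * hF _ _ (k + 1) ≤
    n1 * (hF _ _ k + _) + n2 * (hF _ _ k + _) at hmain
  have hmain' := (Int.cast_le (R := ℚ)).2 hmain
  push_cast at hmain'
  have hk1 : (0 : ℚ) < k + 1 := by positivity
  rw [div_mul_eq_mul_div, div_mul_eq_mul_div, div_mul_eq_mul_div, ← add_div, ← add_div,
    le_div_iff₀ hk1]
  linarith
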